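/- Let K be a real closed differential field with field of constants k, k ≠ K, let A ∈ Mat_n(K), and let L be a Picard–Vessiot field for y′ = Ay over K with fundamental matrix F ∈ GL_n(L). Let R = K[F_{ij} (1 ≤ i,j ≤ n), (det F)^{-1}] ⊆ L be the K-subalgebra of L generated by the entries of F and the inverse of its determinant (the Picard–Vessiot ring, whose field of fractions is L). Then L is a real field if and only if there exists a K-algebra homomorphism R → K. -/

import Mathlib

/-- A derivation on a field `F`. -/
structure FieldDeriv (F : Type) [Field F] : Type where
  d : F → F
  map_add : ∀ a b : F, d (a + b) = d a + d b
  leibniz : ∀ a b : F, d (a * b) = a * d b + d a * b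

/-- A field is (formally) real if `-1` is not a sum of squares. -/
def IsFormallyRealField (F : Type) [Field F] : Prop :=
  ¬ IsSumSq (-1 : F)

/-- A field is real closed if it is real and no proper algebraic extension of it is real. -/
def IsRealClosedField (F : Type) [Field F] : Prop :=
  IsFormallyRealField F ∧
    ∀ (E : Type) [Field E] [Algebra F E], Algebra.IsAlgebraic F E →
      IsFormallyRealField E → Function.Surjective (algebraMap F E)

section RealPicardVessiot

open Polynomial

/-- Polynomials of degree less than `n` satisfy the intermediate value theorem. -/
def HasIVTBelow (F : Type) [Field F] [LinearOrder F] (n : ℕ) : Prop :=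
  ∀ f : F[X], f.natDegree < n → ∀ a b, a < b → f.eval a < 0 → 0 < f.eval b →
    ∃ c, a < c ∧ c < b ∧ f.eval c = 0

/-- All polynomials satisfy the intermediate value theorem. -/
def HasIVT (F : Type) [Field F] [LinearOrder F] : Prop :=
  ∀ n, HasIVTBelow F n

section IVT

variable {F : Type} [Field F] [LinearOrder F] [IsStrictOrderedRing F]

theorem HasIVTBelow.exists_root {n : ℕ} (h : HasIVTBelow F n) {f : F[X]} (hf : f.natDegree < n)
    {a b : F} (hab : a < b) (hs : f.eval a * f.eval b < 0) :
    ∃ c, a < c ∧ c < b ∧ f.eval c = 0 := by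
  rcases mul_neg_iff.1 hs with ⟨h1, h2⟩ | ⟨h1, h2⟩
  · obtain ⟨c, h3, h4, h5⟩ := h (-f) (by simpa using hf) a b hab (by simpa) (by simpa)
    exact ⟨c, h3, h4, by simpa using h5⟩
  · exact h f hf a b hab h1 h2

theorem HasIVT.exists_root (h : HasIVT F) {f : F[X]} {a b : F} (hab : a < b)
    (hs : f.eval a * f.eval b < 0) : ∃ c, a < c ∧ c < b ∧ f.eval c = 0 :=
  (h (f.natDegree + 1)).exists_root (Nat.lt_succ_self _) hab hs

/-- A polynomial without roots in an open interval has constant sign at any two points of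
the closed interval where it does not vanish. -/
theorem HasIVT.mul_pos (h : HasIVT F) {f : F[X]} {p q : F}
    (hf : ∀ c, p < c → c < q → f.eval c ≠ 0) {u v : F} (hpu : p ≤ u) (huq : u ≤ q) (hpv : p ≤ v)
    (hvq : v ≤ q) (hu : f.eval u ≠ 0) (hv : f.eval v ≠ 0) : 0 < f.eval u * f.eval v := by
  by_contra hcon
  have hneg : f.eval u * f.eval v < 0 := lt_of_le_of_ne (not_lt.1 hcon) (mul_ne_zero hu hv)
  rcases lt_trichotomy u v with huv | rfl | huv
  · obtain ⟨c, h1, h2, h3⟩ := h.exists_root huv hneg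
    exact hf c (hpu.trans_lt h1) (h2.trans_le hvq) h3
  · exact absurd hneg (not_lt.2 (mul_self_nonneg _))
  · obtain ⟨c, h1, h2, h3⟩ := h.exists_root huv (by rwa [mul_comm])
    exact hf c (hpv.trans_lt h1) (h2.trans_le huq) h3

/-- **Rolle's theorem** for polynomials, between two consecutive roots. -/
theorem HasIVT.exists_derivative_eq_zero_of_consecutive (h : HasIVT F) {f : F[X]} (hf0 : f ≠ 0)
    {a b : F} (hab : a < b) (ha : f.eval a = 0) (hb : f.eval b = 0)
    (hf : ∀ c, a < c → c < b → f.eval c ≠ 0) : ∃ c, a < c ∧ c < b ∧ f.derivative.eval c = 0 := by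
  obtain ⟨g, hg, hga⟩ := f.exists_eq_pow_rootMultiplicity_mul_and_not_dvd hf0 a
  have hg0 : g ≠ 0 := by rintro rfl; simp at hga
  obtain ⟨e, he, heb⟩ := g.exists_eq_pow_rootMultiplicity_mul_and_not_dvd hg0 b
  obtain ⟨m, hm⟩ : ∃ m, f.rootMultiplicity a = m + 1 :=
    Nat.exists_eq_succ_of_ne_zero ((rootMultiplicity_pos hf0).2 ha).ne'
  obtain ⟨k, hk⟩ : ∃ k, g.rootMultiplicity b = k + 1 := by
    refine Nat.exists_eq_succ_of_ne_zero ((rootMultiplicity_pos hg0).2 ?_).ne'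
    rw [hg, eval_mul] at hb
    refine (mul_eq_zero.1 hb).resolve_left ?_
    simpa using fun h => absurd h (sub_ne_zero.2 hab.ne')
  rw [hk] at he
  rw [hm] at hg
  have heb' : e.eval b ≠ 0 := fun h0 => heb (dvd_iff_isRoot.2 h0)
  have hea' : e.eval a ≠ 0 := fun h0 => hga (by
    rw [he]; exact Dvd.dvd.mul_left (dvd_iff_isRoot.2 h0) _)
  have hfe : f = (X - C a) ^ (m + 1) * ((X - C b) ^ (k + 1) * e) := by rw [← he, ← hg]
  have hpos : 0 < e.eval a * e.eval b := by
    refine h.mul_pos (p := a) (q := b) ?_ le_rfl hab.le hab.le le_rfl hea' heb'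
    intro c h1 h2 h3
    exact hf c h1 h2 (by simp [hfe, h3])
  set r : F[X] := C ((m : F) + 1) * (X - C b) * e + C ((k : F) + 1) * (X - C a) * e
    + (X - C a) * (X - C b) * derivative e with hr
  have hder : derivative f = (X - C a) ^ m * (X - C b) ^ k * r := by
    rw [hfe, hr]
    simp only [derivative_mul, derivative_pow, derivative_sub, derivative_X, derivative_C]
    simp
    ring
  have hra : r.eval a = ((m : F) + 1) * (a - b) * e.eval a := by simp [hr]
  have hrb : r.eval b = ((k : F) + 1) * (b - a) * e.eval b := by simp [hr]
  obtain ⟨c, h1, h2, h3⟩ := h.exists_root (f := r) hab (by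
    rw [hra, hrb]
    have h1 : (0 : F) < ((m : F) + 1) * ((k : F) + 1) := by positivity
    have h2 : (0 : F) < (b - a) * (b - a) := mul_self_pos.2 (sub_ne_zero.2 hab.ne')
    have h3 := _root_.mul_pos (_root_.mul_pos h1 h2) hpos
    linarith)
  exact ⟨c, h1, h2, by rw [hder]; simp [h3]⟩

/-- **Rolle's theorem** for polynomials. -/
theorem HasIVT.exists_derivative_eq_zero (h : HasIVT F) {f : F[X]} {a b : F} (hab : a < b)
    (hf : f.eval a = f.eval b) : ∃ c, a < c ∧ c < b ∧ f.derivative.eval c = 0 := by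
  set g := f - C (f.eval a) with hg
  have hd : derivative g = derivative f := by simp [hg]
  have hga : g.eval a = 0 := by simp [hg]
  have hgb : g.eval b = 0 := by simp [hg, hf]
  rw [← hd]
  by_cases hg0 : g = 0
  · obtain ⟨c, h1, h2⟩ := exists_between hab
    exact ⟨c, h1, h2, by simp [hg0]⟩
  · have hne : (g.roots.toFinset.filter (a < ·)).Nonempty :=
      ⟨b, by simp [hg0, hgb, hab]⟩
    have hmem := Finset.min'_mem _ hne
    set d := Finset.min' _ hne with hd'
    simp only [Finset.mem_filter, Multiset.mem_toFinset, mem_roots hg0] at hmem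
    have hdb : d ≤ b := Finset.min'_le _ _ (by simp [hg0, hgb, hab])
    obtain ⟨c, h1, h2, h3⟩ := h.exists_derivative_eq_zero_of_consecutive hg0 hmem.2 hga hmem.1
      (fun c h1 h2 h3 => absurd (Finset.min'_le (g.roots.toFinset.filter (a < ·)) c
        (by simp [hg0, h3, h1])) (not_le.2 h2))
    exact ⟨c, h1, h2.trans_le hdb, h3⟩

theorem HasIVT.strictMonoOn_of_derivative_pos (h : HasIVT F) {f : F[X]} {p q : F}
    (hf : ∀ c, p < c → c < q → 0 < f.derivative.eval c) {u v : F} (hpu : p ≤ u) (huv : u < v)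
    (hvq : v ≤ q) : f.eval u < f.eval v := by
  set s := (f.eval v - f.eval u) / (v - u) with hs
  have hvu : v - u ≠ 0 := (sub_pos.2 huv).ne'
  have hs' : s * (v - u) = f.eval v - f.eval u := div_mul_cancel₀ _ hvu
  obtain ⟨c, h1, h2, h3⟩ := h.exists_derivative_eq_zero (f := f - C s * X) huv (by
    simp only [eval_sub, eval_mul, eval_C, eval_X]; linarith)
  have h4 : f.derivative.eval c = s := by
    simpa [sub_eq_zero] using h3
  have h5 := hf c (hpu.trans_lt h1) (h2.trans_le hvq)
  rw [h4] at h5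
  have := _root_.mul_pos h5 (sub_pos.2 huv)
  linarith

/-- If the derivative has no root in an open interval, the polynomial is, up to sign,
strictly increasing on the closed interval. -/
theorem HasIVT.strictMonoOn_or (h : HasIVT F) {f : F[X]} {p q : F}
    (hf : ∀ c, p < c → c < q → f.derivative.eval c ≠ 0) :
    (∀ u v, p ≤ u → u < v → v ≤ q → f.eval u < f.eval v) ∨
    (∀ u v, p ≤ u → u < v → v ≤ q → f.eval v < f.eval u) := by
  by_cases hpq : p < q
  swap
  · left; intro u v h1 h2 h3
    exact absurd (h1.trans_lt (h2.trans_le h3)) hpq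
  obtain ⟨y, hpy, hyq⟩ := exists_between hpq
  have hsgn : ∀ c, p < c → c < q → 0 < f.derivative.eval y * f.derivative.eval c := fun c h1 h2 =>
    h.mul_pos hf hpy.le hyq.le h1.le h2.le (hf y hpy hyq) (hf c h1 h2)
  rcases (hf y hpy hyq).lt_or_gt with hy | hy
  · right
    intro u v h1 h2 h3
    have := h.strictMonoOn_of_derivative_pos (f := -f) (p := p) (q := q) (fun c h4 h5 => by
      have := hsgn c h4 h5
      simp only [derivative_neg, eval_neg, Left.neg_pos_iff]
      exact (neg_iff_neg_of_mul_pos this).1 hy) h1 h2 h3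
    simpa using this
  · left
    intro u v h1 h2 h3
    exact h.strictMonoOn_of_derivative_pos (fun c h4 h5 => (pos_iff_pos_of_mul_pos
      (hsgn c h4 h5)).1 hy) h1 h2 h3

/-- Values of a nonzero polynomial are bounded away from zero outside a bounded interval. -/
theorem exists_bound_of_ne_zero (g : F[X]) (hg : g ≠ 0) : ∃ M ε : F, 0 < M ∧ 0 < ε ∧
    ∀ {E : Type} [Field E] [LinearOrder E] [IsStrictOrderedRing E] (φ : F →+* E),
      StrictMono φ → ∀ y, φ M < |y| → φ ε ≤ |g.eval₂ φ y| := by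
  induction hn : g.natDegree using Nat.strong_induction_on generalizing g with
  | _ n ih =>
  rcases Nat.eq_zero_or_pos n with rfl | hpos
  · obtain ⟨c, rfl⟩ := natDegree_eq_zero.1 hn
    have hc : c ≠ 0 := by rintro rfl; simp at hg
    refine ⟨1, |c|, one_pos, abs_pos.2 hc, ?_⟩
    intro E _ _ _ φ hφ y hy
    rw [eval₂_C]
    rcases abs_cases c with ⟨h1, h2⟩ | ⟨h1, h2⟩
    · rw [h1]; exact le_abs_self _
    · rw [h1, map_neg]; exact neg_le_abs _
  · have hd : g.divX ≠ 0 := by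
      intro h0
      have := natDegree_divX_eq_natDegree_tsub_one (p := g)
      have h1 := divX_mul_X_add g
      rw [h0, zero_mul, zero_add] at h1
      rw [← h1, natDegree_C] at hn
      omega
    obtain ⟨M, ε, hM, hε, H⟩ := ih (g.divX.natDegree) (by
      rw [natDegree_divX_eq_natDegree_tsub_one]; omega) g.divX hd rfl
    have hq : 0 ≤ (|g.coeff 0| + ε) / ε := by positivity
    refine ⟨M + (|g.coeff 0| + ε) / ε, ε, by positivity, hε, ?_⟩
    intro E _ _ _ φ hφ y hy
    have hε' : 0 < φ ε := by simpa using hφ hε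
    have hM' : 0 < φ M := by simpa using hφ hM
    have hq' : 0 ≤ φ ((|g.coeff 0| + ε) / ε) := by simpa using hφ.monotone hq
    rw [map_add] at hy
    have h1 := H φ hφ y (by linarith)
    have h2 : g.eval₂ φ y = g.divX.eval₂ φ y * y + φ (g.coeff 0) := by
      conv_lhs => rw [← divX_mul_X_add g]
      simp
    have h3 : |φ (g.coeff 0)| ≤ φ |g.coeff 0| := abs_le.2
      ⟨by rw [← map_neg]; exact hφ.monotone (neg_abs_le _), hφ.monotone (le_abs_self _)⟩
    have h4 : φ (|g.coeff 0| + ε) ≤ |y| * φ ε := by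
      have : φ ((|g.coeff 0| + ε) / ε) ≤ |y| := by linarith
      have h5 := mul_le_mul_of_nonneg_right this hε'.le
      rwa [← map_mul, div_mul_cancel₀ _ hε.ne'] at h5
    have h5 : |y| * φ ε ≤ |g.divX.eval₂ φ y * y| := by
      rw [abs_mul, mul_comm]
      exact mul_le_mul_of_nonneg_right h1 (abs_nonneg _)
    have h6 : |g.divX.eval₂ φ y * y| ≤ |g.eval₂ φ y| + |φ (g.coeff 0)| := by
      rw [h2]
      calc _ = |(eval₂ φ y g.divX * y + φ (g.coeff 0)) - φ (g.coeff 0)| := by ring_nf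
        _ ≤ _ := abs_sub _ _
    rw [map_add] at h4
    linarith

end IVT

/-- Around an element outside of `F`, an interval with endpoints in `F` can be shrunk so as to
avoid a finite subset of `F`. -/
theorem exists_interval_avoiding {F E : Type} [Field F] [LinearOrder F] [Field E] [LinearOrder E]
    {φ : F →+* E} {y : E}
    (hy : y ∉ Set.range φ) (Z : Finset F) {p q : F} (hp : φ p < y) (hq : y < φ q) :
    ∃ p' q', p ≤ p' ∧ q' ≤ q ∧ φ p' < y ∧ y < φ q' ∧ ∀ z ∈ Z, p' < z → z < q' → False := by
  have h1 : (insert p (Z.filter (φ · < y))).Nonempty := Finset.insert_nonempty _ _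
  have h2 : (insert q (Z.filter (y < φ ·))).Nonempty := Finset.insert_nonempty _ _
  refine ⟨Finset.max' _ h1, Finset.min' _ h2, Finset.le_max' _ _ (by simp),
    Finset.min'_le _ _ (by simp), ?_, ?_, ?_⟩
  · rcases Finset.mem_insert.1 (Finset.max'_mem _ h1) with h | h
    · rwa [h]
    · exact (Finset.mem_filter.1 h).2
  · rcases Finset.mem_insert.1 (Finset.min'_mem _ h2) with h | h
    · rwa [h]
    · exact (Finset.mem_filter.1 h).2
  · intro z hz hpz hzq
    rcases lt_trichotomy (φ z) y with h | h | h
    · exact absurd (Finset.le_max' _ z (by simp [hz, h])) (not_le.2 hpz)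
    · exact hy ⟨z, h⟩
    · exact absurd (Finset.min'_le _ z (by simp [hz, h])) (not_le.2 hzq)

theorem eval_map_ringHom {F E : Type} [Field F] [Field E] (φ : F →+* E) (g : F[X]) (c : F) :
    (g.map φ).eval (φ c) = φ (g.eval c) := by
  rw [eval_map, eval₂_hom]

section Embeddings

variable {F E E' : Type} [Field F] [LinearOrder F] [IsStrictOrderedRing F]
  [Field E'] [LinearOrder E'] [IsStrictOrderedRing E']
  [Field E] [LinearOrder E] [IsStrictOrderedRing E]

/-- If `F` satisfies the intermediate value theorem below degree `n`, then roots of polynomials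
of degree less than `n` over `F` in an ordered extension field lie in `F`. -/
theorem HasIVTBelow.mem_range_of_root {n : ℕ} (hF : HasIVTBelow F n) (hE : HasIVT E)
    {φ : F →+* E} (hφ : StrictMono φ) {g : F[X]} (hg : g ≠ 0) (hgn : g.natDegree < n) {y : E}
    (hy : (g.map φ).eval y = 0) : y ∈ Set.range φ := by
  induction hm : g.natDegree using Nat.strong_induction_on generalizing g y with
  | _ m ih =>
  by_contra hyr
  have hinj : Function.Injective φ := hφ.injective
  have hm0 : m ≠ 0 := by
    rintro rfl
    obtain ⟨c, rfl⟩ := natDegree_eq_zero.1 hm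
    have : c = 0 := by simpa using hy
    simp [this] at hg
  have hg' : derivative g ≠ 0 := fun h0 => hm0 (hm ▸ derivative_eq_zero.1 h0)
  have hdeg : (derivative g).natDegree < m := hm ▸ natDegree_derivative_lt (hm ▸ hm0)
  obtain ⟨M, ε, hM, hε, H⟩ := exists_bound_of_ne_zero g hg
  have hyM : |y| ≤ φ M := by
    by_contra hcon
    have := H φ hφ y (not_le.1 hcon)
    rw [← eval_map, hy, abs_zero] at this
    exact absurd (hφ hε) (not_lt.2 (by simpa using this))
  have hyM' := abs_le.1 hyM
  obtain ⟨p, q, -, -, hpy, hyq, hZ⟩ := exists_interval_avoiding hyr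
    (derivative g).roots.toFinset (p := -M) (q := M)
    (lt_of_le_of_ne (by simpa using hyM'.1) (fun h => hyr ⟨_, h⟩))
    (lt_of_le_of_ne hyM'.2 (fun h => hyr ⟨_, h.symm⟩))
  have hpq : p < q := hφ.lt_iff_lt.1 (hpy.trans hyq)
  have hnr : ∀ c, φ p < c → c < φ q → (g.map φ).derivative.eval c ≠ 0 := by
    intro c h1 h2 h3
    rw [derivative_map] at h3
    obtain ⟨z, rfl⟩ := ih _ hdeg hg' ((hdeg.trans (hm ▸ hgn))) h3 rfl
    rw [eval_map_ringHom, map_eq_zero] at h3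
    exact hZ z (by simp [hg', h3]) (hφ.lt_iff_lt.1 h1) (hφ.lt_iff_lt.1 h2)
  have key : ∃ c, p < c ∧ c < q ∧ g.eval c = 0 := by
    refine hF.exists_root hgn hpq ?_
    rw [← hφ.lt_iff_lt, map_mul, map_zero, ← eval_map_ringHom, ← eval_map_ringHom]
    rcases hE.strictMonoOn_or hnr with hmono | hmono
    · have h1 := hmono _ _ le_rfl hpy hyq.le
      have h2 := hmono _ _ hpy.le hyq le_rfl
      rw [hy] at h1 h2
      exact mul_neg_of_neg_of_pos h1 h2
    · have h1 := hmono _ _ le_rfl hpy hyq.le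
      have h2 := hmono _ _ hpy.le hyq le_rfl
      rw [hy] at h1 h2
      exact mul_neg_of_pos_of_neg h1 h2
  obtain ⟨c, hpc, hcq, hc⟩ := key
  have hc' : (g.map φ).eval (φ c) = 0 := by rw [eval_map_ringHom, hc, map_zero]
  rcases lt_trichotomy (φ c) y with h | h | h
  · obtain ⟨d, h1, h2, h3⟩ := hE.exists_derivative_eq_zero h (hc'.trans hy.symm)
    exact hnr d ((hφ hpc).trans h1) (h2.trans hyq) h3
  · exact hyr ⟨c, h⟩
  · obtain ⟨d, h1, h2, h3⟩ := hE.exists_derivative_eq_zero h (hy.trans hc'.symm)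
    exact hnr d (hpy.trans h1) (h2.trans (hφ hcq)) h3

/-- Elements of two ordered extensions realizing the same cut of `F`, outside of `F`. -/
structure SameCut (φ : F →+* E) (ψ : F →+* E') (y : E) (z : E') : Prop where
  lt_iff : ∀ c, φ c < y ↔ ψ c < z
  gt_iff : ∀ c, y < φ c ↔ z < ψ c
  notMem : y ∉ Set.range φ

/-- Elements realizing the same cut give the same sign to polynomials of small degree. -/
theorem SameCut.pos_iff {φ : F →+* E} {ψ : F →+* E'} {y : E} {z : E'} (hyz : SameCut φ ψ y z)
    {n : ℕ} (hF : HasIVTBelow F n) (hE : HasIVT E) (hE' : HasIVT E') (hφ : StrictMono φ)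
    (hψ : StrictMono ψ) {g : F[X]} (hgn : g.natDegree < n) :
    0 < (g.map φ).eval y ↔ 0 < (g.map ψ).eval z := by
  have const {L : Type} [Field L] [LinearOrder L] [IsStrictOrderedRing L] (hL : HasIVT L)
      {χ : F →+* L} (hχ : StrictMono χ) {g : F[X]} (hg : g ≠ 0) (hgn : g.natDegree < n)
      (hr : ∀ r, g.eval r ≠ 0) (u : L) : 0 < (g.map χ).eval u ↔ 0 < g.eval 0 := by
    have hne : ∀ v, (g.map χ).eval v ≠ 0 := by
      intro v hv
      obtain ⟨r, rfl⟩ := hF.mem_range_of_root hL hχ hg hgn hv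
      rw [eval_map_ringHom, map_eq_zero] at hv
      exact hr r hv
    rw [← hχ.lt_iff_lt, ← eval_map_ringHom, map_zero]
    exact pos_iff_pos_of_mul_pos (hL.mul_pos (p := min u 0) (q := max u 0)
      (fun c _ _ => hne c) (min_le_left _ _) (le_max_left _ _) (min_le_right _ _)
      (le_max_right _ _) (hne u) (hne 0))
  induction hm : g.natDegree using Nat.strong_induction_on generalizing g with
  | _ m ih =>
  by_cases hg : g = 0
  · simp [hg]
  by_cases hr : ∃ r, g.eval r = 0
  · obtain ⟨r, hr⟩ := hr
    obtain ⟨h, rfl⟩ := dvd_iff_isRoot.2 hr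
    have hh : h ≠ 0 := right_ne_zero_of_mul hg
    rw [natDegree_mul (X_sub_C_ne_zero r) hh, natDegree_X_sub_C] at hm hgn
    have ihp := ih h.natDegree (by omega) (by omega) rfl
    have ihn := ih (-h).natDegree (by rw [natDegree_neg]; omega) (by rw [natDegree_neg]; omega) rfl
    simp only [Polynomial.map_neg, eval_neg, Left.neg_pos_iff] at ihn
    have h1 := hyz.lt_iff r
    have h2 := hyz.gt_iff r
    simp only [Polynomial.map_mul, eval_mul, Polynomial.map_sub, map_X, map_C, eval_sub, eval_X,
      eval_C, mul_pos_iff, sub_pos, sub_neg, ihp, ihn, h1, h2]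
  · push Not at hr
    rw [const hE hφ hg hgn hr, const hE' hψ hg hgn hr]

end Embeddings

section Embeddings

variable {F E E' : Type} [Field F] [LinearOrder F] [IsStrictOrderedRing F]
  [Field E'] [LinearOrder E'] [IsStrictOrderedRing E']
  [Field E] [LinearOrder E] [IsStrictOrderedRing E]

/-- If `F` fails the intermediate value theorem in degree `n` but not below, then any two
ordered extensions which satisfy it contain elements outside of `F` at which the polynomials
over `F` have the same signs. -/
theorem HasIVTBelow.exists_eval_pos_iff {n : ℕ} (hF : HasIVTBelow F n)
    (hn : ¬ HasIVTBelow F (n + 1)) (hE : HasIVT E) (hE' : HasIVT E') {φ : F →+* E} {ψ : F →+* E'}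
    (hφ : StrictMono φ) (hψ : StrictMono ψ) : ∃ y z, y ∉ Set.range φ ∧
      ∀ g : F[X], 0 < (g.map φ).eval y ↔ 0 < (g.map ψ).eval z := by
  unfold HasIVTBelow at hn
  push Not at hn
  obtain ⟨f, hfn, p, q, hpq, hfp, hfq, hroot⟩ := hn
  have hfn' : f.natDegree = n := by
    by_contra hne
    obtain ⟨c, h1, h2, h3⟩ := hF f (by omega) p q hpq hfp hfq
    exact hroot c h1 h2 h3
  have hf0 : f.natDegree ≠ 0 := by
    intro h0
    obtain ⟨c, rfl⟩ := natDegree_eq_zero.1 h0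
    simp only [eval_C] at hfp hfq
    exact absurd hfp hfq.not_gt
  have hd0 : derivative f ≠ 0 := fun h0 => hf0 (derivative_eq_zero.1 h0)
  have hdn : (derivative f).natDegree < n := hfn' ▸ natDegree_derivative_lt hf0
  have neg_iff {L : Type} [Field L] [LinearOrder L] [IsStrictOrderedRing L] {χ : F →+* L}
      (hχ : StrictMono χ) (c : F) : (f.map χ).eval (χ c) < 0 ↔ f.eval c < 0 := by
    rw [eval_map_ringHom, ← map_zero χ, hχ.lt_iff_lt]
  have pos_iff {L : Type} [Field L] [LinearOrder L] [IsStrictOrderedRing L] {χ : F →+* L}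
      (hχ : StrictMono χ) (c : F) : 0 < (f.map χ).eval (χ c) ↔ 0 < f.eval c := by
    rw [eval_map_ringHom, ← map_zero χ, hχ.lt_iff_lt]
  obtain ⟨y, hpy, hyq, hy⟩ := hE _ (f.map φ) (Nat.lt_succ_self _) _ _ (hφ hpq)
    ((neg_iff hφ p).2 hfp) ((pos_iff hφ q).2 hfq)
  have hyr : y ∉ Set.range φ := by
    rintro ⟨c, rfl⟩
    rw [eval_map_ringHom, map_eq_zero] at hy
    exact hroot c (hφ.lt_iff_lt.1 hpy) (hφ.lt_iff_lt.1 hyq) hy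
  obtain ⟨p', q', hp', hq', hpy', hyq', hZ⟩ := exists_interval_avoiding hyr
    (derivative f).roots.toFinset hpy hyq
  have hpq' : p' < q' := hφ.lt_iff_lt.1 (hpy'.trans hyq')
  have noroot {L : Type} [Field L] [LinearOrder L] [IsStrictOrderedRing L] (hL : HasIVT L)
      {χ : F →+* L} (hχ : StrictMono χ) :
      ∀ c, χ p' < c → c < χ q' → (f.map χ).derivative.eval c ≠ 0 := by
    intro c h1 h2 h3
    rw [derivative_map] at h3
    obtain ⟨z, rfl⟩ := hF.mem_range_of_root hL hχ hd0 hdn h3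
    rw [eval_map_ringHom, map_eq_zero] at h3
    exact hZ z (by simp [hd0, h3]) (hχ.lt_iff_lt.1 h1) (hχ.lt_iff_lt.1 h2)
  have hyd : (f.map φ).derivative.eval y ≠ 0 := noroot hE hφ y hpy' hyq'
  have hsgn : f.eval p' * f.eval q' < 0 := by
    rw [← hφ.lt_iff_lt, map_mul, map_zero, ← eval_map_ringHom, ← eval_map_ringHom]
    rcases hE.strictMonoOn_or (noroot hE hφ) with hm | hm
    · have h1 := hm _ _ le_rfl hpy' hyq'.le
      have h2 := hm _ _ hpy'.le hyq' le_rfl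
      rw [hy] at h1 h2
      exact mul_neg_of_neg_of_pos h1 h2
    · have h1 := hm _ _ le_rfl hpy' hyq'.le
      have h2 := hm _ _ hpy'.le hyq' le_rfl
      rw [hy] at h1 h2
      exact mul_neg_of_pos_of_neg h1 h2
  obtain ⟨z, hpz, hzq, hz⟩ := hE'.exists_root (f := f.map ψ) (hψ hpq') (by
    rw [eval_map_ringHom, eval_map_ringHom, ← map_mul, ← map_zero ψ]
    exact hψ hsgn)
  -- position of an element of `F` relative to the root, in terms of signs
  have cut {L : Type} [Field L] [LinearOrder L] [IsStrictOrderedRing L] (hL : HasIVT L)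
      {χ : F →+* L} (hχ : StrictMono χ) {u : L} (hpu : χ p' < u) (huq : u < χ q')
      (hu : (f.map χ).eval u = 0) (c : F) :
      (χ c < u ↔ c ≤ p' ∨ c < q' ∧ 0 < f.eval p' * f.eval c) ∧
      (u < χ c ↔ q' ≤ c ∨ p' < c ∧ 0 < f.eval q' * f.eval c) := by
    have aux : ∀ c, p' < c → c < q' → (χ c < u ↔ 0 < f.eval p' * f.eval c) ∧
        (u < χ c ↔ 0 < f.eval q' * f.eval c) := by
      intro c h1 h2
      have e1 : χ (f.eval p' * f.eval c) = (f.map χ).eval (χ p') * (f.map χ).eval (χ c) := by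
        rw [map_mul, ← eval_map_ringHom, ← eval_map_ringHom]
      have e2 : χ (f.eval q' * f.eval c) = (f.map χ).eval (χ q') * (f.map χ).eval (χ c) := by
        rw [map_mul, ← eval_map_ringHom, ← eval_map_ringHom]
      rw [← hχ.lt_iff_lt (a := 0), ← hχ.lt_iff_lt (a := 0), e1, e2, map_zero]
      have key : ∀ v w, χ p' ≤ v → v < w → w ≤ χ q' →
          ((f.map χ).eval (χ p') < (f.map χ).eval (χ q') → (f.map χ).eval v < (f.map χ).eval w) ∧
          ((f.map χ).eval (χ q') < (f.map χ).eval (χ p') →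
            (f.map χ).eval w < (f.map χ).eval v) := by
        intro v w hv hvw hw
        rcases hL.strictMonoOn_or (noroot hL hχ) with hm | hm
        · exact ⟨fun _ => hm _ _ hv hvw hw,
            fun h => absurd h (hm _ _ le_rfl (hχ hpq') le_rfl).not_gt⟩
        · exact ⟨fun h => absurd h (hm _ _ le_rfl (hχ hpq') le_rfl).not_gt,
            fun _ => hm _ _ hv hvw hw⟩
      have hpc := hχ h1
      have hcq := hχ h2
      have k1 := key _ _ le_rfl hpu huq.le
      have k2 := key _ _ hpu.le huq le_rfl
      have k3 := key _ _ le_rfl hpc hcq.le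
      have k4 := key _ _ hpc.le hcq le_rfl
      have k5 := fun h : χ c < u => key _ _ hpc.le h huq.le
      have k6 := fun h : u < χ c => key _ _ hpu.le h hcq.le
      have hs : (f.map χ).eval (χ p') * (f.map χ).eval (χ q') < 0 := by
        rw [eval_map_ringHom, eval_map_ringHom, ← map_mul, ← map_zero χ]
        exact hχ hsgn
      rw [hu] at k1 k2 k5 k6
      rcases lt_trichotomy (χ c) u with h | h | h
      · have k5 := k5 h
        simp only [h, h.not_gt, true_iff, false_iff, not_lt]
        rcases mul_neg_iff.1 hs with ⟨ha, hb⟩ | ⟨ha, hb⟩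
        · have := k5.2 (hb.trans ha)
          exact ⟨mul_pos ha this, mul_nonpos_of_nonpos_of_nonneg hb.le this.le⟩
        · have := k5.1 (ha.trans hb)
          exact ⟨mul_pos_of_neg_of_neg ha this, mul_nonpos_of_nonneg_of_nonpos hb.le this.le⟩
      · simp [h, hu]
      · have k6 := k6 h
        simp only [h, h.not_gt, true_iff, false_iff, not_lt]
        rcases mul_neg_iff.1 hs with ⟨ha, hb⟩ | ⟨ha, hb⟩
        · have := k6.2 (hb.trans ha)
          exact ⟨mul_nonpos_of_nonneg_of_nonpos ha.le this.le, mul_pos_of_neg_of_neg hb this⟩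
        · have := k6.1 (ha.trans hb)
          exact ⟨mul_nonpos_of_nonpos_of_nonneg ha.le this.le, mul_pos hb this⟩
    rcases le_or_gt c p' with h1 | h1
    · have : χ c < u := (hχ.monotone h1).trans_lt hpu
      simp [this, this.not_gt, h1, h1.not_gt, h1.trans_lt hpq']
    rcases le_or_gt q' c with h2 | h2
    · have : u < χ c := huq.trans_le (hχ.monotone h2)
      simp [this, this.not_gt, h2, h2.not_gt, h1]
    · have := aux c h1 h2
      simp [this.1, this.2, h1, h2, h1.not_ge, h2.not_ge]
  have hcut : SameCut φ ψ y z :=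
    ⟨fun c => by rw [(cut hE hφ hpy' hyq' hy c).1, (cut hE' hψ hpz hzq hz c).1],
      fun c => by rw [(cut hE hφ hpy' hyq' hy c).2, (cut hE' hψ hpz hzq hz c).2], hyr⟩
  refine ⟨y, z, hyr, fun g => ?_⟩
  have hlt : (g % f).natDegree < n := hfn' ▸ natDegree_mod_lt g hf0
  rw [← EuclideanDomain.div_add_mod g f]
  simp only [Polynomial.map_add, Polynomial.map_mul, eval_add, eval_mul, hy, hz, zero_mul, zero_add]
  exact hcut.pos_iff hF hE hE' hφ hψ hlt

end Embeddings

/-- A subring of a product of two ordered fields is sign compatible if the two components of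
each of its elements are simultaneously positive. -/
def SignCompatible {E E' : Type} [Field E] [LinearOrder E] [Field E'] [LinearOrder E']
    (G : Subring (E × E')) : Prop :=
  ∀ u ∈ G, 0 < u.1 ↔ 0 < u.2

theorem exists_maximal_signCompatible {E E' : Type} [Field E] [LinearOrder E] [Field E']
    [LinearOrder E'] {G : Subring (E × E')} (hG : SignCompatible G) :
    ∃ M, G ≤ M ∧ Maximal SignCompatible M := by
  refine zorn_le_nonempty₀ {M : Subring (E × E') | SignCompatible M} ?_ G hG
  intro c hc hchain y hy
  refine ⟨sSup c, ?_, fun z hz => le_sSup hz⟩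
  intro u hu
  obtain ⟨N, hN, huN⟩ := (Subring.mem_sSup_of_directedOn ⟨y, hy⟩ hchain.directedOn).1 hu
  exact hc hN u huN

section Maximal

variable {E E' : Type} [Field E] [LinearOrder E] [IsStrictOrderedRing E]
  [Field E'] [LinearOrder E'] [IsStrictOrderedRing E']

namespace SignCompatible

variable {G : Subring (E × E')}

theorem neg_iff (hG : SignCompatible G) {u : E × E'} (hu : u ∈ G) : u.1 < 0 ↔ u.2 < 0 := by
  simpa using hG (-u) (neg_mem hu)

theorem eq_zero_iff (hG : SignCompatible G) {u : E × E'} (hu : u ∈ G) : u.1 = 0 ↔ u.2 = 0 := by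
  have h1 := hG u hu
  have h2 := hG.neg_iff hu
  constructor
  · intro h
    simp only [h, lt_self_iff_false, false_iff, not_lt] at h1 h2
    exact le_antisymm h1 h2
  · intro h
    simp only [h, lt_self_iff_false, iff_false, not_lt] at h1 h2
    exact le_antisymm h1 h2

theorem inv_mem (hG : Maximal SignCompatible G) {u : E × E'} (hu : u ∈ G) (hu0 : u.1 ≠ 0) :
    (u.1⁻¹, u.2⁻¹) ∈ G := by
  have hu0' : u.2 ≠ 0 := fun h => hu0 ((hG.1.eq_zero_iff hu).2 h)
  let G' : Subring (E × E') :=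
    { carrier := {v | ∃ N, v * u ^ N ∈ G}
      mul_mem' := by
        rintro v w ⟨N, hN⟩ ⟨M, hM⟩
        refine ⟨N + M, ?_⟩
        have := mul_mem hN hM
        rwa [mul_mul_mul_comm, ← pow_add] at this
      one_mem' := ⟨0, by simp⟩
      add_mem' := by
        rintro v w ⟨N, hN⟩ ⟨M, hM⟩
        refine ⟨N + M, ?_⟩
        have := add_mem (mul_mem hN (pow_mem hu M)) (mul_mem hM (pow_mem hu N))
        convert this using 1
        ring
      zero_mem' := ⟨0, by simp [zero_mem G]⟩
      neg_mem' := by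
        rintro v ⟨N, hN⟩
        exact ⟨N, by simp [hN]⟩ }
  have hle : G ≤ G' := fun v hv => ⟨0, by simpa using hv⟩
  refine hG.2 (y := G') ?_ hle ⟨1, ?_⟩
  · rintro v ⟨N, hN⟩
    have h1 := hG.1 _ (mul_mem hN (pow_mem hu N))
    have h2 : 0 < u.1 ^ N * u.1 ^ N := mul_self_pos.2 (pow_ne_zero _ hu0)
    have h3 : 0 < u.2 ^ N * u.2 ^ N := mul_self_pos.2 (pow_ne_zero _ hu0')
    simpa [mul_assoc, mul_pos_iff_of_pos_right, h2, h3] using h1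
  · have : ((u.1⁻¹, u.2⁻¹) : E × E') * u ^ 1 = 1 := by
      ext <;> simp [hu0, hu0']
    rw [this]
    exact one_mem G

/-- A sign compatible subring is contained in the graph of an embedding of ordered fields whose
source satisfies the intermediate value theorem. -/
theorem exists_subfield_hasIVT (hG : SignCompatible G) (hE : HasIVT E) (hE' : HasIVT E') :
    ∃ (H : Subfield E) (β : H →+* E'), HasIVT H ∧ StrictMono β ∧
      ∀ u ∈ G, ∃ h : u.1 ∈ H, β ⟨u.1, h⟩ = u.2 := by
  obtain ⟨M, hGM, hM⟩ := exists_maximal_signCompatible hG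
  let H : Subfield E :=
    { M.map (RingHom.fst E E') with
      inv_mem' := by
        rintro _ ⟨u, hu, rfl⟩
        by_cases h0 : u.1 = 0
        · exact ⟨0, zero_mem M, by simp [h0]⟩
        · exact ⟨_, inv_mem hM hu h0, rfl⟩ }
  have hmem : ∀ u ∈ M, u.1 ∈ H := fun u hu => ⟨u, hu, rfl⟩
  have hex : ∀ x : H, ∃ z, (x.1, z) ∈ M := by
    rintro ⟨_, ⟨u, hu, rfl⟩⟩
    exact ⟨u.2, hu⟩
  choose b hb using hex
  have huniq : ∀ (x : H) z, (x.1, z) ∈ M → b x = z := by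
    intro x z hz
    have := (hM.1.eq_zero_iff (sub_mem (hb x) hz)).1 (by simp)
    exact sub_eq_zero.1 this
  let β : H →+* E' :=
    { toFun := b
      map_one' := huniq 1 1 (one_mem M)
      map_zero' := huniq 0 0 (zero_mem M)
      map_mul' := fun x y => huniq _ _ (mul_mem (hb x) (hb y))
      map_add' := fun x y => huniq _ _ (add_mem (hb x) (hb y)) }
  have hβ : StrictMono β := by
    intro x y hxy
    have := (hM.1 _ (sub_mem (hb y) (hb x))).1 (sub_pos.2 hxy)
    exact sub_pos.1 this
  have hβM : ∀ x : H, (x.1, β x) ∈ M := hb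
  have hα : StrictMono H.subtype := fun x y hxy => hxy
  refine ⟨H, β, ?_, hβ, fun u hu => ⟨hmem u (hGM hu), huniq _ _ (hGM hu)⟩⟩
  by_contra hcon
  unfold HasIVT at hcon
  push Not at hcon
  classical
  have hn := Nat.find_spec hcon
  have hmin := fun m => Nat.find_min hcon (m := m)
  obtain ⟨n, hn'⟩ : ∃ n, Nat.find hcon = n + 1 := by
    refine Nat.exists_eq_succ_of_ne_zero fun h0 => ?_
    rw [h0] at hn
    exact hn fun f hf => absurd hf (Nat.not_lt_zero _)
  rw [hn'] at hn hmin
  obtain ⟨y, z, hy, hyz⟩ := HasIVTBelow.exists_eval_pos_iff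
    (not_not.1 (hmin n (Nat.lt_succ_self n))) hn hE hE' hα hβ
  have hle : M ≤ ((eval₂RingHom H.subtype y).prod (eval₂RingHom β z)).range := by
    intro u hu
    refine ⟨C ⟨u.1, hmem u hu⟩, Prod.ext ?_ ?_⟩
    · simp
    · simpa [β] using huniq ⟨u.1, hmem u hu⟩ u.2 hu
  have hsign : SignCompatible ((eval₂RingHom H.subtype y).prod (eval₂RingHom β z)).range := by
    rintro _ ⟨g, rfl⟩
    simpa [← eval_map] using hyz g
  exact hy ⟨⟨y, hmem (y, z) (hM.2 hsign hle ⟨X, by simp⟩)⟩, rfl⟩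

end SignCompatible

end Maximal

section Ultrapower

open Filter

theorem HasIVT.germ {F : Type} [Field F] [LinearOrder F] (h : HasIVT F) {ι : Type}
    (U : Ultrafilter ι) :
    HasIVT (Germ (U : Filter ι) F) := by
  intro n f hf a b hab hfa hfb
  induction a using Germ.inductionOn with | _ a =>
  induction b using Germ.inductionOn with | _ b =>
  have hlift : ∀ i, ∃ c : ι → F, (c : Germ (U : Filter ι) F) = f.coeff i := fun i =>
    Quotient.exists_rep (f.coeff i)
  choose c hc using hlift
  set g : ι → F[X] := fun s => ∑ i ∈ Finset.range (f.natDegree + 1), C (c i s) * X ^ i with hg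
  have heval : ∀ u : ι → F,
      f.eval (u : Germ (U : Filter ι) F) = ((fun s => (g s).eval (u s) : ι → F) : Germ _ F) := by
    intro u
    have h1 : (fun s => (g s).eval (u s)) =
        ∑ i ∈ Finset.range (f.natDegree + 1), c i * u ^ i := by
      ext s
      simp [hg, eval_finsetSum, Finset.sum_apply]
    rw [h1, eval_eq_sum_range, ← Germ.coe_coeRingHom, map_sum]
    simp [hc]
  rw [heval, ← Germ.coe_zero, Germ.coe_lt] at hfa hfb
  rw [Germ.coe_lt] at hab
  have hex : ∀ᶠ s in (U : Filter ι), ∃ d, a s < d ∧ d < b s ∧ (g s).eval d = 0 := by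
    filter_upwards [hab, hfa, hfb] with s h1 h2 h3
    exact h _ (g s) (Nat.lt_succ_self _) _ _ h1 h2 h3
  obtain ⟨d, hd⟩ := hex.choice
  refine ⟨(d : Germ _ F), ?_, ?_, ?_⟩
  · rw [Germ.coe_lt]
    exact hd.mono fun s hs => hs.1
  · rw [Germ.coe_lt]
    exact hd.mono fun s hs => hs.2.1
  · rw [heval, ← Germ.coe_zero]
    exact Germ.coe_eq.2 (hd.mono fun s hs => hs.2.2)

/-- The embedding of a field into its ultrapower. -/
def ultrapowerConst (F : Type) [Field F] {ι : Type} (U : Ultrafilter ι) :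
    F →+* Germ (U : Filter ι) F :=
  (Germ.coeRingHom (U : Filter ι)).comp (Pi.constRingHom ι F)

theorem ultrapowerConst_strictMono {F : Type} [Field F] [LinearOrder F] {ι : Type}
    (U : Ultrafilter ι) :
    StrictMono (ultrapowerConst F U) :=
  fun _ _ h => Germ.const_lt h

variable {F E : Type} [Field F] [LinearOrder F] [IsStrictOrderedRing F]
  [Field E] [LinearOrder E] [IsStrictOrderedRing E]

/-- An element of an ordered extension field of `F` can be mimicked in an ultrapower of `F`. -/
theorem HasIVT.exists_ultrapower_eval_pos_iff (hF : HasIVT F) (hE : HasIVT E) {φ : F →+* E}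
    (hφ : StrictMono φ) (x : E) : ∃ (ι : Type) (U : Ultrafilter ι) (z : Germ (U : Filter ι) F),
      ∀ g : F[X], 0 < (g.map φ).eval x ↔ 0 < (g.map (ultrapowerConst F U)).eval z := by
  classical
  let U : Ultrafilter (Finset F) := Ultrafilter.of atTop
  have hU : (U : Filter (Finset F)) ≤ atTop := Ultrafilter.of_le _
  refine ⟨Finset F, U, ?_⟩
  by_cases hx : x ∈ Set.range φ
  · obtain ⟨c, rfl⟩ := hx
    refine ⟨ultrapowerConst F U c, fun g => ?_⟩
    rw [eval_map_ringHom, eval_map_ringHom, ← map_zero φ, hφ.lt_iff_lt,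
      ← map_zero (ultrapowerConst F U), (ultrapowerConst_strictMono U).lt_iff_lt]
  have hex : ∀ s : Finset F, ∃ a, ∀ c ∈ s, (φ c < x → c < a) ∧ (x < φ c → a < c) := by
    intro s
    obtain ⟨a, h1, h2⟩ := Order.exists_between_finsets (s.filter (φ · < x)) (s.filter (x < φ ·))
      (by
        intro u hu v hv
        exact hφ.lt_iff_lt.1 ((Finset.mem_filter.1 hu).2.trans (Finset.mem_filter.1 hv).2))
    exact ⟨a, fun c hc => ⟨fun h => h1 c (by simp [hc, h]), fun h => h2 c (by simp [hc, h])⟩⟩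
  choose a ha using hex
  have hev : ∀ c : F, ∀ᶠ s in (U : Filter (Finset F)), c ∈ s := fun c =>
    hU ((eventually_ge_atTop {c}).mono fun s hs => hs (Finset.mem_singleton_self c))
  have h1 : ∀ c, φ c < x → ultrapowerConst F U c < (a : Germ (U : Filter (Finset F)) F) :=
    fun c hc => Germ.coe_lt.2 ((hev c).mono fun s hs => (ha s c hs).1 hc)
  have h2 : ∀ c, x < φ c → (a : Germ (U : Filter (Finset F)) F) < ultrapowerConst F U c :=
    fun c hc => Germ.coe_lt.2 ((hev c).mono fun s hs => (ha s c hs).2 hc)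
  have htri : ∀ c, φ c < x ∨ x < φ c := fun c => lt_or_gt_of_ne fun h => hx ⟨c, h⟩
  have hcut : SameCut φ (ultrapowerConst F U) x (a : Germ (U : Filter (Finset F)) F) :=
    ⟨fun c => ⟨h1 c, fun h => (htri c).resolve_right fun h' => h.not_gt (h2 c h')⟩,
      fun c => ⟨h2 c, fun h => (htri c).resolve_left fun h' => h.not_gt (h1 c h')⟩, hx⟩
  exact ⟨a, fun g => hcut.pos_iff (hF _) hE (hF.germ U) hφ (ultrapowerConst_strictMono U)
    (Nat.lt_succ_self _)⟩

theorem HasIVT.exists_subfield_mem (hF : HasIVT F) (hE : HasIVT E) {φ : F →+* E}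
    (hφ : StrictMono φ) (x : E) : ∃ (ι : Type) (U : Ultrafilter ι) (H : Subfield E)
      (φ' : F →+* H) (β : H →+* Germ (U : Filter ι) F), HasIVT H ∧ x ∈ H ∧
      H.subtype.comp φ' = φ ∧ β.comp φ' = ultrapowerConst F U := by
  obtain ⟨ι, U, z, hz⟩ := hF.exists_ultrapower_eval_pos_iff hE hφ x
  have hsign : SignCompatible
      ((eval₂RingHom φ x).prod (eval₂RingHom (ultrapowerConst F U) z)).range := by
    rintro _ ⟨g, rfl⟩
    simpa [← eval_map] using hz g
  obtain ⟨H, β, hH, -, hHβ⟩ := hsign.exists_subfield_hasIVT hE (hF.germ U)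
  have hc : ∀ c, ∃ h : φ c ∈ H, β ⟨φ c, h⟩ = ultrapowerConst F U c := fun c =>
    hHβ (φ c, ultrapowerConst F U c) ⟨C c, by simp⟩
  refine ⟨ι, U, H, φ.codRestrict H fun c => (hc c).1, β, hH, (hHβ (x, z) ⟨X, by simp⟩).1, ?_, ?_⟩
  · ext c; rfl
  · ext c; exact (hc c).2

/-- **Artin–Lang**: a point in an ordered extension field specializes to a point over the base
field. -/
theorem HasIVT.exists_eval_eq_zero (hE : HasIVT E) {σ : Type} [Finite σ] (x : σ → E)
    (S : Finset σ) {F : Type} [Field F] [LinearOrder F] [IsStrictOrderedRing F] (hF : HasIVT F)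
    {φ : F →+* E} (hφ : StrictMono φ) (hx : ∀ i ∉ S, x i ∈ Set.range φ) :
    ∃ a : σ → F, ∀ p : MvPolynomial σ F, p.eval₂ φ x = 0 → p.eval a = 0 := by
  classical
  induction S using Finset.induction_on generalizing F with
  | empty =>
    choose a ha using fun i => hx i (Finset.notMem_empty i)
    refine ⟨a, fun p hp => ?_⟩
    obtain rfl : (fun i => φ (a i)) = x := funext ha
    have : φ (p.eval a) = 0 := by
      rw [← hp, ← MvPolynomial.eval₂_id, MvPolynomial.eval₂_comp_left]
      rfl
    exact (map_eq_zero φ).1 this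
  | insert i S hiS ih =>
    obtain ⟨ι, U, H, φ', β, hH, hxi, hφ', hβ⟩ := hF.exists_subfield_mem hE hφ (x i)
    obtain ⟨a', ha'⟩ := ih hH (φ := H.subtype) (fun _ _ h => h) (by
      intro j hj
      by_cases hji : j = i
      · exact ⟨⟨x i, hxi⟩, by simp [hji]⟩
      · obtain ⟨c, hc⟩ := hx j (by simp [hji, hj])
        exact ⟨φ' c, by rw [← hc, ← hφ']; rfl⟩)
    have hlift : ∀ j, ∃ c : ι → F, (c : Germ (U : Filter ι) F) = β (a' j) := fun j =>
      Quotient.exists_rep (β (a' j))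
    choose a ha using hlift
    have hev : ∀ p : MvPolynomial σ F, p.eval₂ φ x = 0 →
        ∀ᶠ s in (U : Filter ι), p.eval (fun j => a j s) = 0 := by
      intro p hp
      have h1 : (MvPolynomial.map φ' p).eval a' = 0 := by
        refine ha' _ ?_
        rw [MvPolynomial.eval₂_map, hφ', hp]
      have h2 : p.eval₂ (ultrapowerConst F U) (fun j => β (a' j)) = 0 := by
        rw [← hβ]
        rw [MvPolynomial.eval_map] at h1
        have := congrArg β h1
        rw [map_zero, MvPolynomial.eval₂_comp_left] at this
        exact this
      have h3 : MvPolynomial.eval₂Hom (ultrapowerConst F U) (fun j => β (a' j)) =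
          (Germ.coeRingHom (U : Filter ι)).comp
            (RingHom.pi fun s => MvPolynomial.eval (fun j => a j s)) := by
        ext
        · simp only [RingHom.comp_apply, MvPolynomial.eval₂Hom_C]
          refine congrArg _ (_root_.funext fun s => ?_)
          simp
        · simp only [MvPolynomial.eval₂Hom_X', RingHom.comp_apply]
          rw [← ha]
          refine congrArg _ (_root_.funext fun s => ?_)
          simp
      have h4 := congrArg (fun f => f p) h3
      simp only [MvPolynomial.coe_eval₂Hom, h2] at h4
      exact Germ.coe_eq.1 h4.symm
    obtain ⟨T, hT⟩ := (isNoetherianRing_iff_ideal_fg _).1 inferInstance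
      (RingHom.ker (MvPolynomial.eval₂Hom φ x))
    obtain ⟨s, hs⟩ := ((Finset.eventually_all T).2 (fun p hp => hev p (by
      have : p ∈ RingHom.ker (MvPolynomial.eval₂Hom φ x) := hT ▸ Ideal.subset_span hp
      exact this))).exists
    refine ⟨fun j => a j s, fun p hp => ?_⟩
    have hle : RingHom.ker (MvPolynomial.eval₂Hom φ x) ≤
        RingHom.ker (MvPolynomial.eval fun j => a j s) := by
      rw [← hT, Ideal.span_le]
      exact fun p hp => hs p hp
    exact hle hp

end Ultrapower

section RealClosed

/-- Sums of squares in `F[X]/(f)` lift to sums of squares of polynomials of small degree. -/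
theorem exists_isSumSq_mk_eq {F : Type} [Field F] {f : F[X]} (hf : f.natDegree ≠ 0)
    {a : AdjoinRoot f} (ha : IsSumSq a) : ∃ q : F[X], IsSumSq q ∧
      q.natDegree ≤ 2 * (f.natDegree - 1) ∧ IsSumSq (q.coeff (2 * (f.natDegree - 1))) ∧
      AdjoinRoot.mk f q = a := by
  induction ha with
  | zero => exact ⟨0, by simp⟩
  | sq_add a hs ih =>
    obtain ⟨q, h1, h2, h3, rfl⟩ := ih
    obtain ⟨g, rfl⟩ := AdjoinRoot.mk_surjective a
    have hlt : (g % f).natDegree ≤ f.natDegree - 1 := Nat.le_sub_one_of_lt (natDegree_mod_lt g hf)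
    have hmk : AdjoinRoot.mk f (g % f) = AdjoinRoot.mk f g := by
      conv_rhs => rw [← EuclideanDomain.div_add_mod g f]
      simp
    refine ⟨(g % f) * (g % f) + q, .sq_add _ h1, ?_, ?_, by simp [hmk]⟩
    · refine (natDegree_add_le _ _).trans (max_le (natDegree_mul_le.trans (by omega)) h2)
    · rw [coeff_add, two_mul, coeff_mul_add_eq_of_natDegree_le hlt hlt, ← two_mul]
      exact .sq_add _ h3

theorem neg_one_eq_mk {F : Type} [Field F] {f : F[X]} {q : F[X]}
    (h : AdjoinRoot.mk f q = -1) : f ∣ q + 1 := by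
  rw [← AdjoinRoot.mk_eq_zero]
  simp [h]

theorem IsSumSq.map_ringHom {A B : Type} [CommRing A] [CommRing B] (φ : A →+* B) {a : A}
    (ha : IsSumSq a) : IsSumSq (φ a) := by
  induction ha with
  | zero => simp
  | sq_add a hs ih => rw [map_add, map_mul]; exact .sq_add _ ih

theorem IsRealClosedField.exists_root {F : Type} [Field F] (hF : IsRealClosedField F) {f : F[X]}
    (hf : Irreducible f) (hr : haveI := Fact.mk hf; IsFormallyRealField (AdjoinRoot f)) :
    ∃ c, f.eval c = 0 := by
  have := Fact.mk hf
  have := (AdjoinRoot.powerBasis hf.ne_zero).finite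
  obtain ⟨c, hc⟩ := hF.2 (AdjoinRoot f) inferInstance hr (AdjoinRoot.root f)
  refine ⟨c, ?_⟩
  have h := AdjoinRoot.eval₂_root f
  rw [← hc, ← AdjoinRoot.algebraMap_eq, eval₂_hom, map_eq_zero] at h
  exact h

theorem IsRealClosedField.isSumSq_neg {F : Type} [Field F] (hF : IsRealClosedField F) {s : F}
    (hs : ¬ IsSquare s) : IsSumSq (-s) := by
  have hd : (X ^ 2 - C s).natDegree = 2 := natDegree_X_pow_sub_C
  have hnr : ∀ c, (X ^ 2 - C s).eval c ≠ 0 := by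
    intro c hc
    refine hs ⟨c, ?_⟩
    rw [← sq, eq_comm]
    simpa [sub_eq_zero] using hc
  have hirr : Irreducible (X ^ 2 - C s) := by
    refine (irreducible_iff_roots_eq_zero_of_degree_le_three (by omega) (by omega)).2 ?_
    refine Multiset.eq_zero_of_forall_notMem fun c hc => hnr c ?_
    exact (mem_roots'.1 hc).2
  have := Fact.mk hirr
  have hreal : ¬ IsFormallyRealField (AdjoinRoot (X ^ 2 - C s)) := fun h =>
    let ⟨c, hc⟩ := hF.exists_root hirr h
    hnr c hc
  obtain ⟨q, h1, h2, h3, h4⟩ := exists_isSumSq_mk_eq (by omega) (not_not.1 hreal)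
  obtain ⟨g, hg⟩ := neg_one_eq_mk h4
  simp only [hd, Nat.reduceSub, mul_one] at h2 h3
  have hg0 : g.natDegree = 0 := by
    by_contra hcon
    have hgne : g ≠ 0 := by rintro rfl; simp at hcon
    have := congrArg natDegree hg
    rw [natDegree_mul hirr.ne_zero hgne, hd] at this
    have := natDegree_add_le q 1
    rw [natDegree_one] at this
    omega
  obtain ⟨c, rfl⟩ := natDegree_eq_zero.1 hg0
  have e0 := congrArg (eval 0) hg
  have e2 := congrArg (fun p => coeff p 2) hg
  simp [coeff_one] at e0 e2
  have ht : IsSumSq (q.eval 0) := h1.map_ringHom (evalRingHom 0)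
  rw [e2] at h3
  have hc : c ≠ 0 := by
    rintro rfl
    refine hF.1 ?_
    rw [show (-1 : F) = q.eval 0 by linear_combination -e0]
    exact ht
  have : -s = (1 + q.eval 0) * c * (c⁻¹ * c⁻¹) := by
    field_simp
    linear_combination -e0
  rw [this]
  exact ((IsSumSq.one.add ht).mul h3).mul (.mul_self _)

theorem IsRealClosedField.isSquare_of_isSumSq {F : Type} [Field F] (hF : IsRealClosedField F)
    {s : F} (hs : IsSumSq s) : IsSquare s := by
  by_contra hcon
  have h0 : s ≠ 0 := by rintro rfl; simp at hcon
  refine hF.1 ?_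
  rw [show (-1 : F) = s * -s * (s⁻¹ * s⁻¹) by field_simp]
  exact (hs.mul (hF.isSumSq_neg hcon)).mul (.mul_self _)

theorem IsRealClosedField.isSquare_or_isSquare_neg {F : Type} [Field F] (hF : IsRealClosedField F)
    (s : F) : IsSquare s ∨ IsSquare (-s) := by
  by_cases h : IsSquare s
  · exact .inl h
  · exact .inr (hF.isSquare_of_isSumSq (hF.isSumSq_neg h))

/-- The order of a real closed field, whose nonnegative elements are the squares. -/
theorem IsRealClosedField.exists_linearOrder {F : Type} [Field F] (hF : IsRealClosedField F) :
    ∃ _ : LinearOrder F, IsStrictOrderedRing F := by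
  classical
  have hadd : ∀ a b : F, IsSquare a → IsSquare b → IsSquare (a + b) := fun a b ha hb =>
    hF.isSquare_of_isSumSq (ha.isSumSq.add hb.isSumSq)
  have hanti : ∀ a : F, IsSquare a → IsSquare (-a) → a = 0 := by
    intro a ha hb
    by_contra h0
    refine hF.1 ?_
    rw [show (-1 : F) = a * -a * (a⁻¹ * a⁻¹) by field_simp]
    exact (ha.isSumSq.mul hb.isSumSq).mul (.mul_self _)
  let O : LinearOrder F :=
    { le := fun a b => IsSquare (b - a)
      le_refl := fun a => by simp
      le_trans := fun a b c h1 h2 => by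
        have := hadd _ _ h1 h2
        rwa [show b - a + (c - b) = c - a by ring] at this
      le_antisymm := fun a b h1 h2 => by
        have := hanti (b - a) h1 (by rwa [neg_sub])
        exact (sub_eq_zero.1 this).symm
      le_total := fun a b => by
        have := hF.isSquare_or_isSquare_neg (b - a)
        rwa [neg_sub] at this
      toDecidableLE := Classical.decRel _ }
  have : IsOrderedAddMonoid F :=
    { add_le_add_left := fun a b h c => by
        change IsSquare (_ - _)
        rw [show b + c - (a + c) = b - a by ring]
        exact h }
  have : ZeroLEOneClass F := ⟨⟨1, by ring⟩⟩
  refine ⟨O, IsStrictOrderedRing.of_mul_pos fun a b ha hb => ?_⟩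
  refine lt_of_le_of_ne ?_ (mul_ne_zero ha.ne' hb.ne').symm
  have h1 : IsSquare (a - 0) := ha.le
  have h2 : IsSquare (b - 0) := hb.le
  change IsSquare (_ - _)
  rw [sub_zero] at *
  exact h1.mul h2

section Ordered

variable {F : Type} [Field F] [LinearOrder F] [IsStrictOrderedRing F]

theorem exists_irreducible_dvd_eval_mul_neg {g : F[X]} {a b : F}
    (hs : g.eval a * g.eval b < 0) : ∃ f, Irreducible f ∧ f ∣ g ∧ f.eval a * f.eval b < 0 := by
  have hg : g ≠ 0 := by rintro rfl; simp at hs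
  induction g using WfDvdMonoid.induction_on_irreducible with
  | zero => exact absurd rfl hg
  | unit u hu =>
    obtain ⟨c, hc, rfl⟩ := isUnit_iff.1 hu
    simp only [eval_C] at hs
    exact absurd hs (mul_self_nonneg c).not_gt
  | mul g i hg0 hi ih =>
    by_cases hneg : i.eval a * i.eval b < 0
    · exact ⟨i, hi, dvd_mul_right _ _, hneg⟩
    · obtain ⟨f, h1, h2, h3⟩ := ih (by
        by_contra hcon
        rw [eval_mul, eval_mul, mul_mul_mul_comm] at hs
        exact absurd hs (mul_nonneg (not_lt.1 hneg) (not_lt.1 hcon)).not_gt) hg0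
      exact ⟨f, h1, h2.mul_left _, h3⟩

/-- Adjoining a root of an irreducible polynomial which changes sign yields a real field. -/
theorem isFormallyRealField_adjoinRoot {f : F[X]} (hf : Irreducible f) {a b : F}
    (hs : f.eval a * f.eval b < 0) :
    haveI := Fact.mk hf; IsFormallyRealField (AdjoinRoot f) := by
  induction hn : f.natDegree using Nat.strong_induction_on generalizing f with
  | _ n ih =>
  intro hsum
  have hf0 : f.natDegree ≠ 0 := by
    intro h0
    obtain ⟨c, rfl⟩ := natDegree_eq_zero.1 h0
    simp only [eval_C] at hs
    exact absurd hs (mul_self_nonneg c).not_gt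
  obtain ⟨q, h1, h2, -, h4⟩ := exists_isSumSq_mk_eq hf0 hsum
  obtain ⟨g, hg⟩ := neg_one_eq_mk h4
  have hpos : ∀ c, 0 < f.eval c * g.eval c := by
    intro c
    have h := (h1.map_ringHom (evalRingHom c)).nonneg
    have e := congrArg (eval c) hg
    simp only [eval_add, eval_one, eval_mul, coe_evalRingHom] at h e
    linarith
  have hgs : g.eval a * g.eval b < 0 := by
    have h := mul_pos (hpos a) (hpos b)
    rw [mul_mul_mul_comm] at h
    exact (neg_iff_neg_of_mul_pos h).1 hs
  have hg0 : g ≠ 0 := by rintro rfl; simp at hgs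
  obtain ⟨i, hi, hig, his⟩ := exists_irreducible_dvd_eval_mul_neg hgs
  have hdeg : i.natDegree < n := by
    have e := congrArg natDegree hg
    rw [natDegree_mul hf.ne_zero hg0] at e
    have h5 := natDegree_add_le q 1
    rw [natDegree_one] at h5
    have := natDegree_le_of_dvd hig hg0
    omega
  refine ih _ hdeg hi his rfl ?_
  have h0 : AdjoinRoot.mk i (q + 1) = 0 := AdjoinRoot.mk_eq_zero.2 (hg ▸ hig.mul_left f)
  rw [map_add, map_one] at h0
  rw [← eq_neg_of_add_eq_zero_left h0]
  exact h1.map_ringHom _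

theorem IsRealClosedField.hasIVT (hF : IsRealClosedField F) : HasIVT F := by
  intro n f _ a b hab ha hb
  obtain ⟨i, hi, ⟨g, rfl⟩, his⟩ :=
    exists_irreducible_dvd_eval_mul_neg (mul_neg_of_neg_of_pos ha hb)
  obtain ⟨c, hc⟩ := hF.exists_root hi (isFormallyRealField_adjoinRoot hi his)
  obtain ⟨u, rfl⟩ := dvd_iff_isRoot.2 hc
  have hu : IsUnit u := (hi.isUnit_or_isUnit rfl).resolve_left (not_isUnit_X_sub_C c)
  obtain ⟨d, -, rfl⟩ := isUnit_iff.1 hu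
  simp only [eval_mul, eval_sub, eval_X, eval_C] at his
  have h : (a - c) * (b - c) < 0 := by
    rw [mul_mul_mul_comm] at his
    exact neg_of_mul_neg_left his (mul_self_nonneg d)
  rcases mul_neg_iff.1 h with ⟨h1, h2⟩ | ⟨h1, h2⟩
  · linarith
  · exact ⟨c, by linarith, by linarith, by simp⟩

end Ordered

/-- Every real field has a real closed extension. -/
theorem IsFormallyRealField.exists_isRealClosedField {L : Type} [Field L]
    (hL : IsFormallyRealField L) : ∃ (E : Type) (_ : Field E) (_ : L →+* E),
      IsRealClosedField E := by
  have transfer {A B : Type} [Field A] [Field B] (φ : A →+* B) (hB : IsFormallyRealField B) :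
      IsFormallyRealField A := fun h => hB (by simpa using h.map_ringHom φ)
  obtain ⟨M, -, hM⟩ := zorn_le_nonempty₀
    {M : IntermediateField L (AlgebraicClosure L) | IsFormallyRealField M} (by
      intro c hc hchain y hy
      have : Nonempty c := ⟨⟨y, hy⟩⟩
      have hdir : Directed (· ≤ ·) fun M : c => M.1 := hchain.directedOn.directed_val
      refine ⟨⨆ M : c, M.1, ?_, fun M hM => le_iSup (fun M : c => M.1) ⟨M, hM⟩⟩
      have key : ∀ a : (⨆ M : c, M.1 : IntermediateField L (AlgebraicClosure L)), IsSumSq a →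
          ∃ M : c, ∃ h : a.1 ∈ M.1, IsSumSq (⟨a.1, h⟩ : M.1) := by
        intro a ha
        induction ha with
        | zero => exact ⟨⟨y, hy⟩, zero_mem _, IsSumSq.zero⟩
        | sq_add b hs ih =>
          obtain ⟨M, h1, h2⟩ := ih
          obtain ⟨N, hN⟩ : ∃ N : c, b.1 ∈ N.1 := by
            have := b.2
            rw [← SetLike.mem_coe, IntermediateField.coe_iSup_of_directed hdir,
              Set.mem_iUnion] at this
            exact this
          obtain ⟨P, hMP, hNP⟩ := hdir M N
          refine ⟨P, add_mem (mul_mem (hNP hN) (hNP hN)) (hMP h1), ?_⟩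
          exact IsSumSq.sq_add (⟨b.1, hNP hN⟩ : P.1)
            (h2.map_ringHom (IntermediateField.inclusion hMP).toRingHom)
      intro hsum
      obtain ⟨M, h1, h2⟩ := key _ hsum
      exact hc M.2 h2) ⊥
    (transfer (IntermediateField.botEquiv L (AlgebraicClosure L)).toAlgHom.toRingHom hL)
  refine ⟨M, inferInstance, algebraMap L M, hM.1, fun E _ _ hE hreal e => ?_⟩
  let j : E →ₐ[M] AlgebraicClosure L := IsAlgClosed.lift
  have hle : M ≤ j.fieldRange.restrictScalars L := fun m hm => ⟨algebraMap M E ⟨m, hm⟩, by simp⟩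
  have hmax := hM.2 (y := j.fieldRange.restrictScalars L)
    (transfer (AlgEquiv.ofInjectiveField j).symm.toAlgHom.toRingHom hreal) hle
  refine ⟨⟨j e, hmax ⟨e, rfl⟩⟩, j.injective ?_⟩
  simp

theorem IsRealClosedField.strictMono {F E : Type} [Field F] [LinearOrder F]
    [IsStrictOrderedRing F] [Field E] [LinearOrder E] [IsStrictOrderedRing E]
    (hF : IsRealClosedField F) (φ : F →+* E) : StrictMono φ := by
  intro a b hab
  have hpos : 0 < b - a := sub_pos.2 hab
  have hsq : IsSquare (b - a) := (hF.isSquare_or_isSquare_neg (b - a)).resolve_right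
    fun h => absurd h.nonneg (by simpa using hpos)
  have h1 : 0 ≤ φ (b - a) := (hsq.map φ).nonneg
  have h2 : φ (b - a) ≠ 0 := (map_ne_zero φ).2 hpos.ne'
  rw [map_sub] at h1 h2
  exact sub_pos.1 (lt_of_le_of_ne h1 h2.symm)

/-- A finitely generated subalgebra of a real field over a real closed field has a rational
point. -/
theorem IsRealClosedField.nonempty_algHom_adjoin {K L : Type} [Field K] [Field L] [Algebra K L]
    (hK : IsRealClosedField K) (hL : IsFormallyRealField L) {S : Set L} (hS : S.Finite) :
    Nonempty (Algebra.adjoin K S →ₐ[K] K) := by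
  obtain ⟨E, _, j, hE⟩ := hL.exists_isRealClosedField
  obtain ⟨_, _⟩ := hK.exists_linearOrder
  obtain ⟨_, _⟩ := hE.exists_linearOrder
  have : Finite S := hS
  have : Fintype S := Fintype.ofFinite S
  obtain ⟨a, ha⟩ := hE.hasIVT.exists_eval_eq_zero (fun s : S => j s) Finset.univ hK.hasIVT
    (hK.strictMono (j.comp (algebraMap K L))) (by simp)
  have hrange : Algebra.adjoin K S =
      (MvPolynomial.aeval fun s : S => (s : L) : MvPolynomial S K →ₐ[K] L).range := by
    rw [← Algebra.adjoin_range_eq_range_aeval, Subtype.range_coe]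
  rw [hrange]
  refine ⟨Ideal.Quotient.liftₐ _ (MvPolynomial.aeval a : MvPolynomial S K →ₐ[K] K) ?_ |>.comp
    (Ideal.quotientKerAlgEquivOfSurjective
      (AlgHom.rangeRestrict_surjective (MvPolynomial.aeval fun s : S => (s : L)))).symm.toAlgHom⟩
  intro p hp
  refine (congrArg (fun f : _ →+* K => f p) (MvPolynomial.coe_aeval_eq_eval a)).trans (ha p ?_)
  have h0 : MvPolynomial.aeval (fun s : S => (s : L)) p = 0 := congrArg Subtype.val hp
  have h1 := congrArg j h0
  rw [map_zero, MvPolynomial.aeval_def, MvPolynomial.eval₂_comp_left] at h1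
  exact h1

end RealClosed

section Taylor

variable {R K : Type} [CommRing R] [Field K]

/-- The Taylor expansion of an element of a differential ring at a point. -/
noncomputable def taylorSeries (D : Derivation ℤ R R) (φ : R →+* K) (r : R) : PowerSeries K :=
  PowerSeries.mk fun n => φ (D^[n] r) / n.factorial

theorem coeff_taylorSeries (D : Derivation ℤ R R) (φ : R →+* K) (r : R) (n : ℕ) :
    PowerSeries.coeff n (taylorSeries D φ r) = φ (D^[n] r) / n.factorial :=
  PowerSeries.coeff_mk _ _

theorem taylorSeries_add (D : Derivation ℤ R R) (φ : R →+* K) (a b : R) :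
    taylorSeries D φ (a + b) = taylorSeries D φ a + taylorSeries D φ b := by
  ext n
  simp [coeff_taylorSeries, iterate_map_add, add_div]

variable [CharZero K]

theorem derivative_taylorSeries (D : Derivation ℤ R R) (φ : R →+* K) (r : R) :
    PowerSeries.derivative K (taylorSeries D φ r) = taylorSeries D φ (D r) := by
  ext n
  rw [PowerSeries.coeff_derivative, coeff_taylorSeries, coeff_taylorSeries,
    Function.iterate_succ_apply, Nat.factorial_succ]
  have h1 : (n.factorial : K) ≠ 0 := by exact_mod_cast n.factorial_ne_zero
  have h2 : (n : K) + 1 ≠ 0 := by exact_mod_cast n.succ_ne_zero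
  push_cast
  field_simp

theorem taylorSeries_mul (D : Derivation ℤ R R) (φ : R →+* K) (a b : R) :
    taylorSeries D φ (a * b) = taylorSeries D φ a * taylorSeries D φ b := by
  ext n
  induction n generalizing a b with
  | zero => simp [PowerSeries.coeff_mul, coeff_taylorSeries]
  | succ n ih =>
    have h2 : (n : K) + 1 ≠ 0 := by exact_mod_cast n.succ_ne_zero
    refine mul_right_cancel₀ h2 ?_
    rw [← PowerSeries.coeff_derivative, ← PowerSeries.coeff_derivative, derivative_taylorSeries,
      Derivation.leibniz, Derivation.leibniz, derivative_taylorSeries, derivative_taylorSeries,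
      taylorSeries_add, map_add, map_add]
    simp only [smul_eq_mul, ih]

/-- The Taylor expansion at a point, as a ring homomorphism. -/
noncomputable def taylorHom (D : Derivation ℤ R R) (φ : R →+* K) : R →+* PowerSeries K where
  toFun := taylorSeries D φ
  map_one' := by
    ext n
    cases n with
    | zero => simp [coeff_taylorSeries]
    | succ n => simp [coeff_taylorSeries, PowerSeries.coeff_one]
  map_zero' := by
    ext n
    simp [coeff_taylorSeries, iterate_map_zero]
  map_mul' := taylorSeries_mul D φ
  map_add' := taylorSeries_add D φ

/-- The fraction field of a differentially simple ring with a point in an ordered field is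
real. -/
theorem isFormallyRealField_of_point {R K : Type} [CommRing R] [Field K] [LinearOrder K]
    [IsStrictOrderedRing K] (D : Derivation ℤ R R)
    (φ : R →+* K) (hD : ∀ I : Ideal R, (∀ a ∈ I, D a ∈ I) → I ≠ ⊤ → I = ⊥)
    (L : Type) [Field L] [Algebra R L] [IsFractionRing R L] : IsFormallyRealField L := by
  have hker : RingHom.ker (taylorHom D φ) = ⊥ := by
    refine hD _ (fun a ha => ?_) (RingHom.ker_ne_top _)
    have h : taylorSeries D φ a = 0 := ha
    change taylorSeries D φ (D a) = 0
    rw [← derivative_taylorSeries, h, map_zero]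
  have hinj : Function.Injective ((HahnSeries.ofPowerSeries ℤ K).comp (taylorHom D φ)) :=
    HahnSeries.ofPowerSeries_injective.comp ((RingHom.injective_iff_ker_eq_bot _).2 hker)
  let ψ : L →+* LaurentSeries K := IsFractionRing.lift hinj
  intro h
  have h1 : IsSumSq (-1 : LaurentSeries K) := by simpa using h.map_ringHom ψ
  have h2 : IsSumSq (-1 : Lex (HahnSeries ℤ K)) := h1
  exact absurd h2.nonneg (by simp)

end Taylor

section CoeffMap

variable {σ L : Type} [Field L]

/-- Apply an additive map to the coefficients of a polynomial. -/
noncomputable def coeffMap (f : L →+ L) (p : MvPolynomial σ L) : MvPolynomial σ L :=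
  AddMonoidAlgebra.map f p

theorem coeff_coeffMap (f : L →+ L) (p : MvPolynomial σ L) (m : σ →₀ ℕ) :
    (coeffMap f p).coeff m = f (p.coeff m) :=
  rfl

theorem coeffMap_zero (f : L →+ L) : coeffMap f (0 : MvPolynomial σ L) = 0 := by
  ext m
  simp [coeff_coeffMap]

theorem coeffMap_add (f : L →+ L) (p q : MvPolynomial σ L) :
    coeffMap f (p + q) = coeffMap f p + coeffMap f q := by
  ext m
  simp [coeff_coeffMap]

theorem coeffMap_C (f : L →+ L) (a : L) :
    coeffMap f (MvPolynomial.C a : MvPolynomial σ L) = MvPolynomial.C (f a) := by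
  classical
  ext m
  simp only [coeff_coeffMap, MvPolynomial.coeff_C]
  split_ifs <;> simp

theorem coeffMap_mul_X (f : L →+ L) (p : MvPolynomial σ L) (i : σ) :
    coeffMap f (p * MvPolynomial.X i) = coeffMap f p * MvPolynomial.X i := by
  classical
  ext m
  simp only [coeff_coeffMap, MvPolynomial.coeff_mul_X']
  split_ifs <;> simp

theorem coeffMap_mul (δ : Derivation ℤ L L) (p q : MvPolynomial σ L) :
    coeffMap (δ : L →+ L) (p * q) =
      p * coeffMap (δ : L →+ L) q + coeffMap (δ : L →+ L) p * q := by
  classical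
  ext m
  simp only [coeff_coeffMap, MvPolynomial.coeff_add, MvPolynomial.coeff_mul, map_sum,
    ← Finset.sum_add_distrib]
  refine Finset.sum_congr rfl fun x _ => ?_
  simp [mul_comm]

theorem eval_coeffMap (δ : Derivation ℤ L L) {b : σ → L} (hb : ∀ i, δ (b i) = 0)
    (p : MvPolynomial σ L) :
    MvPolynomial.eval b (coeffMap (δ : L →+ L) p) = δ (MvPolynomial.eval b p) := by
  induction p using MvPolynomial.induction_on with
  | C a => simp [coeffMap_C]
  | add p q hp hq => simp [coeffMap_add, hp, hq]
  | mul_X p i hp => simp [coeffMap_mul_X, hp, hb, mul_comm]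

/-- A subspace of polynomials stable under the coefficientwise derivation, containing a
polynomial which does not vanish at a constant point, contains such a polynomial with constant
coefficients. -/
theorem exists_coeffMap_eq_zero (δ : Derivation ℤ L L) {b : σ → L} (hb : ∀ i, δ (b i) = 0)
    {J : Submodule L (MvPolynomial σ L)} (hJ : ∀ w ∈ J, coeffMap (δ : L →+ L) w ∈ J)
    {w₀ : MvPolynomial σ L} (hw₀ : w₀ ∈ J) (hw₀b : MvPolynomial.eval b w₀ ≠ 0) :
    ∃ w ∈ J, MvPolynomial.eval b w = 1 ∧ ∀ m, δ (w.coeff m) = 0 := by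
  classical
  obtain ⟨w, ⟨hwJ, hw1⟩, hmin⟩ := (measure fun w : MvPolynomial σ L => w.support.card).wf.has_min
    {w | w ∈ J ∧ MvPolynomial.eval b w = 1}
    ⟨(MvPolynomial.eval b w₀)⁻¹ • w₀, J.smul_mem _ hw₀, by simp [MvPolynomial.smul_eval, hw₀b]⟩
  refine ⟨w, hwJ, hw1, ?_⟩
  by_contra! hcon
  obtain ⟨t, ht⟩ := hcon
  have htw : w.coeff t ≠ 0 := fun h => ht (by rw [h, map_zero])
  refine hmin (w - (w.coeff t / δ (w.coeff t)) • coeffMap (δ : L →+ L) w) ⟨J.sub_mem hwJ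
    (J.smul_mem _ (hJ w hwJ)), ?_⟩ (Finset.card_lt_card ⟨fun m hm => ?_, fun hle => ?_⟩)
  · simp [MvPolynomial.smul_eval, eval_coeffMap δ hb, hw1]
  · rw [MvPolynomial.mem_support_iff] at hm ⊢
    contrapose! hm
    simp [coeff_coeffMap, hm]
  · have := MvPolynomial.mem_support_iff.1 (hle (MvPolynomial.mem_support_iff.2 htw))
    refine this ?_
    simp [coeff_coeffMap, ht]

end CoeffMap

section Simplicity

variable {K L : Type} [Field K] [Field L] [Algebra K L] {n : ℕ}

/-- Substitution of the matrix product `M * Y` of a matrix and the matrix of variables. -/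
noncomputable def substMul (M : Matrix (Fin n) (Fin n) L) :
    MvPolynomial (Fin n × Fin n) K →+* MvPolynomial (Fin n × Fin n) L :=
  MvPolynomial.eval₂Hom (MvPolynomial.C.comp (algebraMap K L))
    fun q => ∑ l, MvPolynomial.C (M q.1 l) * MvPolynomial.X (l, q.2)

/-- A matrix as a point of affine space. -/
def matrixPoint (M : Matrix (Fin n) (Fin n) L) : Fin n × Fin n → L :=
  fun q => M q.1 q.2

theorem eval_substMul (M N : Matrix (Fin n) (Fin n) L) (p : MvPolynomial (Fin n × Fin n) K) :
    MvPolynomial.eval (matrixPoint N) (substMul M p) =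
      MvPolynomial.aeval (matrixPoint (M * N)) p := by
  have : (MvPolynomial.eval (matrixPoint N)).comp (substMul M) =
      (MvPolynomial.aeval (matrixPoint (M * N)) : _ →ₐ[K] L).toRingHom := by
    ext <;> simp [substMul, matrixPoint, Matrix.mul_apply]
  exact congrArg (fun f => f p) this

theorem substMul_substMul {M N : Matrix (Fin n) (Fin n) L} (hMN : M * N = 1)
    (p : MvPolynomial (Fin n × Fin n) K) :
    substMul N (substMul M p) = MvPolynomial.map (algebraMap K L) p := by
  have : (substMul N).comp (substMul M) = MvPolynomial.map (algebraMap K L) := by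
    refine MvPolynomial.ringHom_ext (fun a => by simp [substMul]) fun q => ?_
    obtain ⟨i, j⟩ := q
    have h : ∀ m, ∑ l, M i l * N l m = if i = m then 1 else 0 := fun m => by
      rw [← Matrix.mul_apply, hMN, Matrix.one_apply]
    simp only [substMul, RingHom.comp_apply, MvPolynomial.eval₂Hom_X', map_sum, map_mul,
      MvPolynomial.eval₂Hom_C, MvPolynomial.map_X, Finset.mul_sum,
      Algebra.algebraMap_self, RingHom.id_apply]
    rw [Finset.sum_comm]
    have h' : ∀ m, ∑ l, MvPolynomial.C (M i l) * (MvPolynomial.C (N l m) *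
        MvPolynomial.X (m, j)) = (MvPolynomial.C (if i = m then 1 else 0) *
          MvPolynomial.X (m, j) : MvPolynomial (Fin n × Fin n) L) := fun m => by
      rw [← h m, map_sum, Finset.sum_mul]
      exact Finset.sum_congr rfl fun l _ => by rw [map_mul, mul_assoc]
    refine (Finset.sum_congr rfl fun m _ => h' m).trans ?_
    simp [apply_ite, ite_mul]
  exact congrArg (fun f => f p) this

theorem exists_substMul_eq_coeffMap (δK : Derivation ℤ K K) (δ : Derivation ℤ L L)
    (hext : ∀ a, δ (algebraMap K L a) = algebraMap K L (δK a)) {A : Matrix (Fin n) (Fin n) K}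
    {F : Matrix (Fin n) (Fin n) L} (hF : ∀ i j, δ (F i j) = (A.map (algebraMap K L) * F) i j)
    (p : MvPolynomial (Fin n × Fin n) K) :
    ∃ q : MvPolynomial (Fin n × Fin n) K, substMul F q = coeffMap (δ : L →+ L) (substMul F p) := by
  induction p using MvPolynomial.induction_on with
  | C a => exact ⟨MvPolynomial.C (δK a), by simp [substMul, coeffMap_C, hext]⟩
  | add p q hp hq =>
    obtain ⟨p', hp⟩ := hp
    obtain ⟨q', hq⟩ := hq
    exact ⟨p' + q', by simp [hp, hq, coeffMap_add]⟩
  | mul_X p i hp =>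
    obtain ⟨p', hp⟩ := hp
    obtain ⟨i, j⟩ := i
    refine ⟨p * ∑ m, MvPolynomial.C (A i m) * MvPolynomial.X (m, j) +
      p' * MvPolynomial.X (i, j), ?_⟩
    have key : coeffMap (δ : L →+ L) (substMul F (MvPolynomial.X (i, j) :
        MvPolynomial (Fin n × Fin n) K)) =
        substMul F (∑ m, MvPolynomial.C (A i m) * MvPolynomial.X (m, j)) := by
      have hsum : ∀ (s : Finset (Fin n)) (g : Fin n → MvPolynomial (Fin n × Fin n) L),
          coeffMap (δ : L →+ L) (∑ l ∈ s, g l) = ∑ l ∈ s, coeffMap (δ : L →+ L) (g l) :=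
        fun s g => map_sum (AddMonoidHom.mk' _ (coeffMap_add (δ : L →+ L))) g s
      simp only [substMul, MvPolynomial.eval₂Hom_X', map_sum, map_mul, MvPolynomial.eval₂Hom_C,
        hsum, coeffMap_mul_X, coeffMap_C, Finset.mul_sum]
      rw [Finset.sum_comm]
      refine Finset.sum_congr rfl fun l _ => ?_
      simp [hF, Matrix.mul_apply, map_sum, Finset.sum_mul, mul_assoc]
    rw [map_mul, coeffMap_mul, key, map_add, map_mul, map_mul, hp]

end Simplicity

section Stable

variable {K L : Type} [Field K] [Field L] [Algebra K L] {n : ℕ}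

theorem substMul_map (M : Matrix (Fin n) (Fin n) L) (p : MvPolynomial (Fin n × Fin n) K) :
    substMul M (MvPolynomial.map (algebraMap K L) p) = substMul M p := by
  have : (substMul M).comp (MvPolynomial.map (algebraMap K L)) = substMul M :=
    MvPolynomial.ringHom_ext (fun a => by simp [substMul]) fun q => by simp [substMul]
  exact congrArg (fun f => f p) this

theorem substMul_smul (M : Matrix (Fin n) (Fin n) L) (c : L)
    (p : MvPolynomial (Fin n × Fin n) L) : substMul M (c • p) = c • substMul M p := by
  rw [MvPolynomial.smul_eq_C_mul, MvPolynomial.smul_eq_C_mul, map_mul]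
  simp [substMul]

theorem exists_map_eq_substMul {R : Subalgebra K L} {M : Matrix (Fin n) (Fin n) L}
    (hM : ∀ i j, M i j ∈ R) (p : MvPolynomial (Fin n × Fin n) K) :
    ∃ r : MvPolynomial (Fin n × Fin n) R,
      MvPolynomial.map (algebraMap R L) r = substMul M p := by
  induction p using MvPolynomial.induction_on with
  | C a => exact ⟨MvPolynomial.C (algebraMap K R a), by simp [substMul]⟩
  | add p q hp hq =>
    obtain ⟨p', hp⟩ := hp
    obtain ⟨q', hq⟩ := hq
    exact ⟨p' + q', by simp [hp, hq]⟩
  | mul_X p i hp =>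
    obtain ⟨p', hp⟩ := hp
    refine ⟨p' * ∑ l, MvPolynomial.C ⟨M i.1 l, hM _ _⟩ * MvPolynomial.X (l, i.2), ?_⟩
    rw [map_mul, map_mul, hp]
    simp [substMul]

theorem coeffMap_smul_map {π : L →ₗ[K] L} (c : L) (u : MvPolynomial (Fin n × Fin n) K) :
    coeffMap (π : L →+ L) (c • MvPolynomial.map (algebraMap K L) u) =
      π c • MvPolynomial.map (algebraMap K L) u := by
  ext m
  simp only [coeff_coeffMap, MvPolynomial.coeff_smul, MvPolynomial.coeff_map, smul_eq_mul]
  rw [mul_comm c, ← Algebra.smul_def, mul_comm (π c), ← Algebra.smul_def]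
  exact π.map_smul _ _

/-- A differential submodule of a Picard–Vessiot extension, over a ring containing the entries
of the inverse of the fundamental matrix, contains `1` as soon as it contains a nonzero
polynomial in the entries of the fundamental matrix. -/
theorem one_mem_of_stable (δK : Derivation ℤ K K) (δ : Derivation ℤ L L)
    (hext : ∀ a, δ (algebraMap K L a) = algebraMap K L (δK a)) {A : Matrix (Fin n) (Fin n) K}
    {F : Matrix (Fin n) (Fin n) L} (hF : ∀ i j, δ (F i j) = (A.map (algebraMap K L) * F) i j)
    (hdet : IsUnit F.det) (hconst : ∀ x, δ x = 0 → x ∈ (algebraMap K L).range)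
    {R : Subalgebra K L} (hR : ∀ i j, F⁻¹ i j ∈ R) {N : Submodule R L}
    (hN : ∀ x ∈ N, δ x ∈ N) {p : MvPolynomial (Fin n × Fin n) K}
    (hp : MvPolynomial.aeval (matrixPoint F) p ∈ N)
    (hp0 : MvPolynomial.aeval (matrixPoint F) p ≠ 0) : (1 : L) ∈ N := by
  have hone : ∀ i, δ (matrixPoint (1 : Matrix (Fin n) (Fin n) L) i) = 0 := fun i => by
    rw [matrixPoint, Matrix.one_apply]
    split_ifs <;> simp
  set J : Submodule L (MvPolynomial (Fin n × Fin n) L) := Submodule.span L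
    {w | ∃ u : MvPolynomial (Fin n × Fin n) K,
      MvPolynomial.aeval (matrixPoint F) u ∈ N ∧ substMul F u = w} with hJdef
  have hJ : ∀ w ∈ J, coeffMap (δ : L →+ L) w ∈ J := fun w hw => by
    induction hw using Submodule.span_induction with
    | mem w hw =>
      obtain ⟨u, hu, rfl⟩ := hw
      obtain ⟨q, hq⟩ := exists_substMul_eq_coeffMap δK δ hext hF u
      rw [← hq]
      refine Submodule.subset_span ⟨q, ?_, rfl⟩
      have h1 := eval_substMul F 1 q
      have h2 := eval_substMul F 1 u
      rw [mul_one] at h1 h2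
      rw [← h1, hq, eval_coeffMap δ hone, h2]
      exact hN _ hu
    | zero => rw [coeffMap_zero]; exact J.zero_mem
    | add v w _ _ hv hw => rw [coeffMap_add]; exact J.add_mem hv hw
    | smul c w hw h =>
      rw [MvPolynomial.smul_eq_C_mul, coeffMap_mul, coeffMap_C, ← MvPolynomial.smul_eq_C_mul,
        ← MvPolynomial.smul_eq_C_mul]
      exact J.add_mem (J.smul_mem _ h) (J.smul_mem _ hw)
  obtain ⟨w, hwJ, hw1, hwc⟩ := exists_coeffMap_eq_zero δ hone hJ
    (Submodule.subset_span ⟨p, hp, rfl⟩ : substMul F p ∈ J) (by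
      rwa [eval_substMul, mul_one])
  obtain ⟨wK, rfl⟩ : ∃ wK, MvPolynomial.map (algebraMap K L) wK = w :=
    MvPolynomial.mem_range_map_iff_coeffs_subset.2 fun x hx => by
      obtain ⟨m, -, rfl⟩ := MvPolynomial.mem_coeffs_iff.1 hx
      exact hconst _ (hwc m)
  obtain ⟨g, hg⟩ := LinearMap.exists_leftInverse_of_injective R.val.toLinearMap
    (LinearMap.ker_eq_bot.2 Subtype.val_injective)
  let π : L →ₗ[K] L := R.val.toLinearMap ∘ₗ g
  have hπ : ∀ x : R, π x = x := fun x => congrArg (fun f : R →ₗ[K] R => (f x : L)) hg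
  have hspan : ∀ v ∈ J, ∀ c : L, MvPolynomial.eval (matrixPoint F)
      (coeffMap (π : L →+ L) (c • substMul F⁻¹ v)) ∈ N := fun v hv => by
    induction hv using Submodule.span_induction with
    | mem w hw =>
      obtain ⟨u, hu, rfl⟩ := hw
      intro c
      rw [substMul_substMul (Matrix.mul_nonsing_inv F hdet), coeffMap_smul_map,
        MvPolynomial.smul_eval, MvPolynomial.eval_map]
      exact N.smul_mem (g c) hu
    | zero => simp [coeffMap_zero]
    | add v w _ _ hv hw =>
      intro c
      rw [map_add, smul_add, coeffMap_add, map_add]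
      exact N.add_mem (hv c) (hw c)
    | smul a w _ h =>
      intro c
      rw [substMul_smul, smul_smul]
      exact h _
  have := hspan _ hwJ 1
  obtain ⟨r, hr⟩ := exists_map_eq_substMul hR wK
  have hfix : coeffMap (π : L →+ L) (substMul F⁻¹ wK) = substMul F⁻¹ wK := by
    ext m
    rw [coeff_coeffMap, ← hr, MvPolynomial.coeff_map]
    exact hπ _
  rw [one_smul, substMul_map, hfix, eval_substMul, Matrix.nonsing_inv_mul F hdet] at this
  rw [MvPolynomial.eval_map] at hw1
  rw [← hw1]
  exact this

end Stable

section PicardVessiotRing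

/-- The underlying `ℤ`-derivation. -/
def FieldDeriv.toDerivation {F : Type} [Field F] (D : FieldDeriv F) : Derivation ℤ F F :=
  Derivation.mk' (AddMonoidHom.mk' D.d D.map_add).toIntLinearMap fun a b => by
    simp [D.leibniz, mul_comm (D.d a)]

variable {K L : Type} [Field K] [Field L] [Algebra K L] {n : ℕ}

theorem Matrix.det_mem_subalgebra {R : Subalgebra K L} {M : Matrix (Fin n) (Fin n) L}
    (hM : ∀ i j, M i j ∈ R) : M.det ∈ R := by
  rw [Matrix.det_apply]
  exact R.sum_mem fun σ _ => R.zsmul_mem (R.prod_mem fun i _ => hM _ _) _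

theorem Matrix.inv_mem_subalgebra {R : Subalgebra K L} {M : Matrix (Fin n) (Fin n) L}
    (hM : ∀ i j, M i j ∈ R) (hdet : M.det⁻¹ ∈ R) (i j : Fin n) : M⁻¹ i j ∈ R := by
  rw [Matrix.inv_def, Matrix.smul_apply, Ring.inverse_eq_inv', Matrix.adjugate_apply]
  refine R.mul_mem hdet (Matrix.det_mem_subalgebra fun k l => ?_)
  rw [Matrix.updateRow_apply]
  split_ifs
  · rw [Pi.single_apply]
    split_ifs
    · exact R.one_mem
    · exact R.zero_mem
  · exact hM _ _

/-- The algebra generated by the entries of a matrix and the inverse of its determinant. -/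
abbrev picardVessiotRing (K : Type) {L : Type} [Field K] [Field L] [Algebra K L] {n : ℕ}
    (F : Matrix (Fin n) (Fin n) L) : Subalgebra K L :=
  Algebra.adjoin K ((Set.range fun q : Fin n × Fin n => F q.1 q.2) ∪ {F.det⁻¹})

theorem picardVessiotRing.entry_mem (F : Matrix (Fin n) (Fin n) L) (i j : Fin n) :
    F i j ∈ picardVessiotRing K F :=
  Algebra.subset_adjoin (.inl ⟨(i, j), rfl⟩)

theorem picardVessiotRing.inv_det_mem (F : Matrix (Fin n) (Fin n) L) :
    F.det⁻¹ ∈ picardVessiotRing K F :=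
  Algebra.subset_adjoin (.inr rfl)

theorem picardVessiotRing.exists_det_pow_mul_eq {F : Matrix (Fin n) (Fin n) L} (hdet : F.det ≠ 0)
    {x : L} (hx : x ∈ picardVessiotRing K F) :
    ∃ (m : ℕ) (p : MvPolynomial (Fin n × Fin n) K),
      F.det ^ m * x = MvPolynomial.aeval (matrixPoint F) p := by
  have hR : Algebra.adjoin K (Set.range (matrixPoint F)) =
      (MvPolynomial.aeval (matrixPoint F) : _ →ₐ[K] L).range :=
    Algebra.adjoin_range_eq_range_aeval K _
  obtain ⟨d, hd⟩ : F.det ∈ (MvPolynomial.aeval (matrixPoint F) : _ →ₐ[K] L).range :=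
    Matrix.det_mem_subalgebra fun i j => hR ▸ Algebra.subset_adjoin ⟨(i, j), rfl⟩
  replace hd : MvPolynomial.aeval (matrixPoint F) d = F.det := hd
  induction hx using Algebra.adjoin_induction with
  | mem x hx =>
    rcases hx with ⟨q, rfl⟩ | rfl
    · exact ⟨0, MvPolynomial.X q, by simp [matrixPoint]⟩
    · exact ⟨1, 1, by simp [hdet]⟩
  | algebraMap a => exact ⟨0, MvPolynomial.C a, by simp⟩
  | add x y _ _ hx hy =>
    obtain ⟨k, p, hp⟩ := hx
    obtain ⟨l, q, hq⟩ := hy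
    refine ⟨k + l, d ^ l * p + d ^ k * q, ?_⟩
    simp only [map_add, map_mul, map_pow, hd, ← hp, ← hq]
    ring
  | mul x y _ _ hx hy =>
    obtain ⟨k, p, hp⟩ := hx
    obtain ⟨l, q, hq⟩ := hy
    refine ⟨k + l, p * q, ?_⟩
    rw [map_mul, ← hp, ← hq]
    ring

theorem picardVessiotRing.isFractionRing {F : Matrix (Fin n) (Fin n) L}
    (hgen : IntermediateField.adjoin K (Set.range fun q : Fin n × Fin n => F q.1 q.2) = ⊤) :
    IsFractionRing (picardVessiotRing K F) L := by
  refine IsFractionRing.of_field _ _ fun z => ?_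
  obtain ⟨r, hr, s, hs, rfl⟩ := IntermediateField.mem_adjoin_iff_div.1
    (hgen ▸ IntermediateField.mem_top : z ∈ IntermediateField.adjoin K _)
  exact ⟨⟨r, Algebra.adjoin_mono Set.subset_union_left hr⟩,
    ⟨s, Algebra.adjoin_mono Set.subset_union_left hs⟩, rfl⟩

theorem Algebra.derivation_mem_adjoin {δK : Derivation ℤ K K} {δ : Derivation ℤ L L}
    (hext : ∀ a, δ (algebraMap K L a) = algebraMap K L (δK a)) {S : Set L} {R : Subalgebra K L}
    (hSR : Algebra.adjoin K S ≤ R) (hS : ∀ x ∈ S, δ x ∈ R) {x : L}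
    (hx : x ∈ Algebra.adjoin K S) : δ x ∈ R := by
  induction hx using Algebra.adjoin_induction with
  | mem x hx => exact hS x hx
  | algebraMap a => exact hext a ▸ R.algebraMap_mem _
  | add x y _ _ hx hy => exact map_add δ x y ▸ R.add_mem hx hy
  | mul x y hx hy hx' hy' =>
    rw [Derivation.leibniz]
    exact R.add_mem (R.mul_mem (hSR hx) hy') (R.mul_mem (hSR hy) hx')

theorem picardVessiotRing.derivation_mem {δK : Derivation ℤ K K} {δ : Derivation ℤ L L}
    (hext : ∀ a, δ (algebraMap K L a) = algebraMap K L (δK a)) {A : Matrix (Fin n) (Fin n) K}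
    {F : Matrix (Fin n) (Fin n) L} (hF : ∀ i j, δ (F i j) = (A.map (algebraMap K L) * F) i j)
    {x : L} (hx : x ∈ picardVessiotRing K F) : δ x ∈ picardVessiotRing K F := by
  have hentry : ∀ y ∈ Set.range fun q : Fin n × Fin n => F q.1 q.2,
      δ y ∈ picardVessiotRing K F := by
    rintro _ ⟨q, rfl⟩
    rw [hF, Matrix.mul_apply]
    exact Subalgebra.sum_mem _ fun l _ => Subalgebra.mul_mem _
      (Subalgebra.algebraMap_mem _ _) (entry_mem F _ _)
  refine Algebra.derivation_mem_adjoin hext le_rfl ?_ hx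
  rintro y (hy | rfl)
  · exact hentry y hy
  · rw [Derivation.leibniz_inv, smul_eq_mul]
    refine Subalgebra.mul_mem _ (Subalgebra.neg_mem _ (Subalgebra.pow_mem _ (inv_det_mem F) _)) ?_
    exact Algebra.derivation_mem_adjoin hext (Algebra.adjoin_mono Set.subset_union_left) hentry
      (Matrix.det_mem_subalgebra fun i j => Algebra.subset_adjoin ⟨(i, j), rfl⟩)

/-- A Picard–Vessiot ring whose fraction field has no new constants has no nontrivial
differential ideal. -/
theorem picardVessiotRing.eq_bot_of_stable (δK : Derivation ℤ K K) (δ : Derivation ℤ L L)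
    (hext : ∀ a, δ (algebraMap K L a) = algebraMap K L (δK a)) {A : Matrix (Fin n) (Fin n) K}
    {F : Matrix (Fin n) (Fin n) L} (hF : ∀ i j, δ (F i j) = (A.map (algebraMap K L) * F) i j)
    (hdet : IsUnit F.det) (hconst : ∀ x, δ x = 0 → x ∈ (algebraMap K L).range)
    {I : Ideal (picardVessiotRing K F)} (hI : ∀ a ∈ I, ∃ b ∈ I, (b : L) = δ a) (hI1 : I ≠ ⊤) :
    I = ⊥ := by
  by_contra hbot
  obtain ⟨f, hf, hf0⟩ := Submodule.exists_mem_ne_zero_of_ne_bot hbot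
  obtain ⟨m, p, hp⟩ := exists_det_pow_mul_eq hdet.ne_zero f.2
  have hp0 : MvPolynomial.aeval (matrixPoint F) p ≠ 0 := by
    rw [← hp]
    exact mul_ne_zero (pow_ne_zero _ hdet.ne_zero) fun h => hf0 (Subtype.ext h)
  obtain ⟨x, hx, hx1⟩ := one_mem_of_stable δK δ hext hF hdet hconst
    (Matrix.inv_mem_subalgebra (entry_mem F) (inv_det_mem F))
    (N := Submodule.map (Algebra.linearMap (picardVessiotRing K F) L) I) (by
      rintro _ ⟨a, ha, rfl⟩
      obtain ⟨b, hb, hba⟩ := hI a ha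
      exact ⟨b, hb, hba⟩)
    (hp ▸ ⟨⟨F.det ^ m, Subalgebra.pow_mem _ (Matrix.det_mem_subalgebra (entry_mem F)) m⟩ * f,
      I.mul_mem_left _ hf, rfl⟩) hp0
  refine hI1 ((Ideal.eq_top_iff_one I).2 ?_)
  rwa [show x = 1 from Subtype.ext hx1] at hx

theorem picardVessiotRing.isFormallyRealField (hK : IsRealClosedField K) (δK : Derivation ℤ K K)
    (δ : Derivation ℤ L L) (hext : ∀ a, δ (algebraMap K L a) = algebraMap K L (δK a))
    {A : Matrix (Fin n) (Fin n) K} {F : Matrix (Fin n) (Fin n) L}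
    (hF : ∀ i j, δ (F i j) = (A.map (algebraMap K L) * F) i j) (hdet : IsUnit F.det)
    (hgen : IntermediateField.adjoin K (Set.range fun q : Fin n × Fin n => F q.1 q.2) = ⊤)
    (hconst : ∀ x, δ x = 0 → x ∈ (algebraMap K L).range)
    (φ : picardVessiotRing K F →ₐ[K] K) : IsFormallyRealField L := by
  obtain ⟨_, _⟩ := hK.exists_linearOrder
  have := isFractionRing hgen
  let D : Derivation ℤ (picardVessiotRing K F) (picardVessiotRing K F) :=
    Derivation.mk' (AddMonoidHom.mk' (fun x : picardVessiotRing K F =>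
      (⟨δ x, derivation_mem hext hF x.2⟩ : picardVessiotRing K F))
      fun a b => Subtype.ext (map_add δ (a : L) b)).toIntLinearMap
      fun a b => Subtype.ext (δ.leibniz (a : L) b)
  exact isFormallyRealField_of_point D φ.toRingHom
    (fun I hI hI1 => eq_bot_of_stable δK δ hext hF hdet hconst
      (fun a ha => ⟨D a, hI a ha, rfl⟩) hI1) L

end PicardVessiotRing

end RealPicardVessiot

/-- Let `K` be a real closed differential field with field of constants
`k ≠ K`, let `L` be a Picard--Vessiot field for `y' = A y` over `K` with fundamental
matrix `F`, and let `R = K[F_{ij}, (det F)⁻¹] ⊆ L` be the Picard--Vessiot ring.  Then `L`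
is a real field if and only if there exists a `K`-algebra homomorphism `R → K`. -/
theorem real_iff_point_of_picard_vessiot_ring
    (K : Type) [Field K] [CharZero K] (dK : FieldDeriv K)
    (hKrc : IsRealClosedField K)
    (hkK : ∃ a : K, dK.d a ≠ 0)
    (n : ℕ) (A : Matrix (Fin n) (Fin n) K)
    (L : Type) [Field L] [Algebra K L] (dL : FieldDeriv L)
    (hext : ∀ a : K, dL.d (algebraMap K L a) = algebraMap K L (dK.d a))
    (F : Matrix (Fin n) (Fin n) L) (hF : IsUnit F.det)
    (hFd : ∀ i j, dL.d (F i j) = (A.map (algebraMap K L) * F) i j)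
    (hgen : IntermediateField.adjoin K (Set.range fun q : Fin n × Fin n => F q.1 q.2) = ⊤)
    (hconst : ∀ x : L, dL.d x = 0 → ∃ a : K, dK.d a = 0 ∧ algebraMap K L a = x) :
    IsFormallyRealField L ↔
      Nonempty ((Algebra.adjoin K
        ((Set.range fun q : Fin n × Fin n => F q.1 q.2) ∪ {F.det⁻¹})) →ₐ[K] K) := by
  constructor
  · exact fun h => hKrc.nonempty_algHom_adjoin h
      ((Set.finite_range _).union (Set.finite_singleton _))
  · rintro ⟨φ⟩
    exact picardVessiotRing.isFormallyRealField hKrc dK.toDerivation dL.toDerivation hext hFd hF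
      hgen (fun x hx => (hconst x hx).imp fun a ha => ha.2) φ
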